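/- arXiv:math/0411409 — 4 statements merged into one kernel-verified Lean document; each statement's English description precedes it below -/
import Mathlib

section
/- For all n ≥ 0 and all s ≥ 0, Tor_n^R(R/J, J^s) is a free module over L = R/J (the L-module structure coming from the first variable). -/
/-!
Statement 6: for all `n, s ≥ 0`, `Tor_n^R(L, J^s)` is a free `L = R/J`-module.
(Freeness over `L` is expressed by an `R`-linear isomorphism with a direct sum
`ι →₀ L` of copies of `L`.)
-/

open CategoryTheory

noncomputable section

namespace ModuleCat

open MonoidalCategory Limits

universe u

variable {R : Type u} [CommRing R]

/-- The functor `M ↦ Q ⊗ M` for a fixed chain complex `Q`. -/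
@[simps]
def tensorComplex (Q : ChainComplex (ModuleCat.{u} R) ℕ) :
    ModuleCat.{u} R ⥤ ChainComplex (ModuleCat.{u} R) ℕ where
  obj M := ((tensorRight M).mapHomologicalComplex _).obj Q
  map f := (NatTrans.mapHomologicalComplex ((tensoringRight _).map f) _).app Q

variable (Q : ChainComplex (ModuleCat.{u} R) ℕ)

instance : (tensorComplex Q).Additive where
  map_add {M N f g} := by
    ext i : 1
    exact MonoidalPreadditive.whiskerLeft_add _ _

instance : (tensorComplex Q).Linear R where
  map_smul f r := by
    ext i : 1
    exact MonoidalLinear.whiskerLeft_smul _ _ _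

lemma homologyMap_smul {K K' : ChainComplex (ModuleCat.{u} R) ℕ} (f : K ⟶ K') (r : R) (n : ℕ) :
    HomologicalComplex.homologyMap (r • f) n = r • HomologicalComplex.homologyMap f n := by
  have h := ShortComplex.homologyMap_smul
    ((HomologicalComplex.shortComplexFunctor (ModuleCat.{u} R) _ n).map f) r
  exact h

lemma shortExact_map_tensorComplex [∀ i, Module.Flat R (Q.X i)] {S : ShortComplex (ModuleCat.{u} R)}
    (hS : S.ShortExact) : (S.map (tensorComplex Q)).ShortExact := by
  refine HomologicalComplex.shortExact_of_degreewise_shortExact _ fun i => ?_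
  exact hS.map_of_exact (tensorLeft (Q.X i))

lemma exactAt_tensorComplex {n : ℕ} (h : Q.ExactAt n) (M : ModuleCat.{u} R) [Module.Flat R M] :
    ((tensorComplex Q).obj M).ExactAt n :=
  Module.Flat.rTensor_shortComplex_exact M _ h

section

variable (M N K : Type u) [AddCommGroup M] [Module R M] [AddCommGroup N] [Module R N]
  [AddCommGroup K] [Module R K]

/-- The homology of `Q ⊗ M` in degree `n`. -/
abbrev tensorHomology (n : ℕ) : Type u := ((tensorComplex Q).obj (of R M)).homology n

variable {M N K}

/-- The map induced on `tensorHomology` by a linear map. -/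
def tensorHomologyMap (n : ℕ) (f : M →ₗ[R] N) : tensorHomology Q M n →ₗ[R] tensorHomology Q N n :=
  (HomologicalComplex.homologyMap ((tensorComplex Q).map (ofHom f)) n).hom

lemma tensorHomologyMap_id (n : ℕ) :
    tensorHomologyMap Q n (LinearMap.id : M →ₗ[R] M) = LinearMap.id := by
  rw [tensorHomologyMap, ofHom_id, CategoryTheory.Functor.map_id, HomologicalComplex.homologyMap_id]
  rfl

lemma tensorHomologyMap_comp (n : ℕ) (g : N →ₗ[R] K) (f : M →ₗ[R] N) :
    tensorHomologyMap Q n (g ∘ₗ f) = tensorHomologyMap Q n g ∘ₗ tensorHomologyMap Q n f := by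
  rw [tensorHomologyMap, ofHom_comp, Functor.map_comp, HomologicalComplex.homologyMap_comp]
  rfl

lemma tensorHomologyMap_add (n : ℕ) (f g : M →ₗ[R] N) :
    tensorHomologyMap Q n (f + g) = tensorHomologyMap Q n f + tensorHomologyMap Q n g := by
  rw [tensorHomologyMap, ofHom_add, Functor.map_add, HomologicalComplex.homologyMap_add]
  rfl

lemma tensorHomologyMap_smul (n : ℕ) (r : R) (f : M →ₗ[R] N) :
    tensorHomologyMap Q n (r • f) = r • tensorHomologyMap Q n f := by
  have : ofHom (r • f) = r • ofHom f := rfl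
  rw [tensorHomologyMap, this, Functor.map_smul, homologyMap_smul]
  rfl

lemma subsingleton_tensorHomology [Module.Flat R M] {n : ℕ} (h : Q.ExactAt n) :
    Subsingleton (tensorHomology Q M n) := by
  have : Module.Flat R (of R M) := ‹_›
  exact subsingleton_of_isZero (exactAt_tensorComplex Q h (of R M)).isZero_homology

variable {A B C : Type u} [AddCommGroup A] [Module R A] [AddCommGroup B] [Module R B]
  [AddCommGroup C] [Module R C] {f : A →ₗ[R] B} {g : B →ₗ[R] C}
  (hf : Function.Injective f) (hfg : Function.Exact f g) (hg : Function.Surjective g)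

include hf hfg hg in
lemma shortExact_of_linearMap :
    (ShortComplex.mk (ofHom f) (ofHom g)
      (by ext x; exact hfg.apply_apply_eq_zero x)).ShortExact :=
  { exact := (ShortComplex.ShortExact.moduleCat_exact_iff_function_exact _).2 hfg
    mono_f := (mono_iff_injective _).2 hf
    epi_g := (epi_iff_surjective _).2 hg }

variable [∀ i, Module.Flat R (Q.X i)]

/-- The connecting homomorphism. -/
def tensorHomologyδ (n : ℕ) : tensorHomology Q C (n + 1) →ₗ[R] tensorHomology Q A n :=
  ((shortExact_map_tensorComplex Q (shortExact_of_linearMap hf hfg hg)).δ (n + 1) n rfl).hom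

lemma tensorHomology_exact₁ (n : ℕ) :
    Function.Exact (tensorHomologyδ Q hf hfg hg n) (tensorHomologyMap Q n f) :=
  (ShortComplex.ShortExact.moduleCat_exact_iff_function_exact _).1
    ((shortExact_map_tensorComplex Q (shortExact_of_linearMap hf hfg hg)).homology_exact₁ (n + 1) n
      rfl)

include hf hfg hg in
lemma tensorHomology_exact₂ (n : ℕ) :
    Function.Exact (tensorHomologyMap Q n f) (tensorHomologyMap Q n g) :=
  (ShortComplex.ShortExact.moduleCat_exact_iff_function_exact _).1
    ((shortExact_map_tensorComplex Q (shortExact_of_linearMap hf hfg hg)).homology_exact₂ n)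

lemma tensorHomology_exact₃ (n : ℕ) :
    Function.Exact (tensorHomologyMap Q (n + 1) g) (tensorHomologyδ Q hf hfg hg n) :=
  (ShortComplex.ShortExact.moduleCat_exact_iff_function_exact _).1
    ((shortExact_map_tensorComplex Q (shortExact_of_linearMap hf hfg hg)).homology_exact₃ (n + 1) n
      rfl)

lemma tensorHomologyδ_naturality {A' B' C' : Type u} [AddCommGroup A'] [Module R A']
    [AddCommGroup B'] [Module R B'] [AddCommGroup C'] [Module R C'] {f' : A' →ₗ[R] B'}
    {g' : B' →ₗ[R] C'} (hf' : Function.Injective f') (hfg' : Function.Exact f' g')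
    (hg' : Function.Surjective g') (a : A →ₗ[R] A') (b : B →ₗ[R] B') (c : C →ₗ[R] C')
    (hab : f' ∘ₗ a = b ∘ₗ f) (hbc : g' ∘ₗ b = c ∘ₗ g) (n : ℕ) :
    tensorHomologyMap Q n a ∘ₗ tensorHomologyδ Q hf hfg hg n =
      tensorHomologyδ Q hf' hfg' hg' n ∘ₗ tensorHomologyMap Q (n + 1) c := by
  have hS := shortExact_of_linearMap hf hfg hg
  have hS' := shortExact_of_linearMap hf' hfg' hg'
  let φ : ShortComplex.mk (ofHom f) (ofHom g)
      (by ext x; exact hfg.apply_apply_eq_zero x) ⟶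
    ShortComplex.mk (ofHom f') (ofHom g') (by ext x; exact hfg'.apply_apply_eq_zero x) :=
    { τ₁ := ofHom a, τ₂ := ofHom b, τ₃ := ofHom c
      comm₁₂ := by ext x; exact LinearMap.congr_fun hab x
      comm₂₃ := by ext x; exact LinearMap.congr_fun hbc x }
  exact congrArg Hom.hom (HomologicalComplex.HomologySequence.δ_naturality
    ((tensorComplex Q).mapShortComplex.map φ) (shortExact_map_tensorComplex Q hS)
    (shortExact_map_tensorComplex Q hS') (n + 1) n rfl)

end


section

open HomologicalComplex ChainComplex TensorProduct

variable {L : ModuleCat.{u} R} (P : ProjectiveResolution L)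

instance (i : ℕ) : Module.Flat R (P.complex.X i) := by
  have : Module.Projective R (P.complex.X i) :=
    (IsProjective.iff_projective _).2 (P.projective i)
  infer_instance

/-- The augmentation of a projective resolution, as a linear map. -/
def augmentation : P.complex.X 0 →ₗ[R] L := (P.π.f 0).hom

lemma augmentation_surjective : Function.Surjective (augmentation P) :=
  (epi_iff_surjective (P.π.f 0)).1 inferInstance

lemma exact_augmentation : Function.Exact (P.complex.d 1 0).hom (augmentation P) :=
  (ShortComplex.ShortExact.moduleCat_exact_iff_function_exact _).1 P.exact₀

/-- The augmentation exhibits `L ⊗ M` as a cokernel. -/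
def isColimitAugmentation (M : ModuleCat.{u} R) :
    IsColimit (CokernelCofork.ofπ (f := ((tensorComplex P.complex).obj M).d 1 0)
      (ofHom ((augmentation P).rTensor M))
      (by
        ext1
        exact (rTensor_exact M (exact_augmentation P)
          (augmentation_surjective P)).linearMap_comp_eq_zero)) := by
  let S : ShortComplex (ModuleCat.{u} R) :=
    .mk (((tensorComplex P.complex).obj M).d 1 0) (ofHom ((augmentation P).rTensor M)) (by
      ext1
      exact (rTensor_exact M (exact_augmentation P)
        (augmentation_surjective P)).linearMap_comp_eq_zero)
  have hS : S.Exact :=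
    (ShortComplex.ShortExact.moduleCat_exact_iff_function_exact _).2
      (rTensor_exact M (exact_augmentation P) (augmentation_surjective P))
  have : Epi S.g :=
    (epi_iff_surjective _).2 (LinearMap.rTensor_surjective M (augmentation_surjective P))
  exact hS.gIsCokernel

/-- The homology of `P ⊗ M` in degree `0` is `L ⊗ M`. -/
def homologyZeroIso (M : ModuleCat.{u} R) :
    ((tensorComplex P.complex).obj M).homology 0 ≅ of R (L ⊗[R] M) :=
  isoHomologyι₀ _ ≪≫ (opcyclesIsCokernel _ 1 0 (by simp)).coconePointUniqueUpToIso
    (isColimitAugmentation P M)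

lemma pOpcycles_homologyZeroIso (M : ModuleCat.{u} R) :
    pOpcycles _ 0 ≫ (isoHomologyι₀ _).inv ≫ (homologyZeroIso P M).hom =
      ofHom ((augmentation P).rTensor M) := by
  rw [homologyZeroIso, Iso.trans_hom, Iso.inv_hom_id_assoc]
  exact IsColimit.comp_coconePointUniqueUpToIso_hom (opcyclesIsCokernel _ 1 0 (by simp))
    (isColimitAugmentation P M) WalkingParallelPair.one

lemma homologyZeroIso_naturality {M N : ModuleCat.{u} R} (f : M ⟶ N) :
    homologyMap ((tensorComplex P.complex).map f) 0 ≫ (homologyZeroIso P N).hom =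
      (homologyZeroIso P M).hom ≫ ofHom (f.hom.lTensor L) := by
  have h := congrArg (· ≫ ofHom (f.hom.lTensor L)) (pOpcycles_homologyZeroIso P M)
  simp only [Category.assoc] at h
  rw [← cancel_epi (isoHomologyι₀ _).inv, ← cancel_epi (pOpcycles _ 0),
    isoHomologyι₀_inv_naturality_assoc, p_opcyclesMap_assoc, pOpcycles_homologyZeroIso,
    h]
  ext1
  exact (LinearMap.rTensor_comp_lTensor _ _ _).trans (LinearMap.lTensor_comp_rTensor _ _ _).symm

variable {M N : Type u} [AddCommGroup M] [Module R M] [AddCommGroup N] [Module R N]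

/-- The homology of `P ⊗ M` in degree `0` is `L ⊗ M`. -/
def tensorHomologyZero (M : Type u) [AddCommGroup M] [Module R M] :
    tensorHomology P.complex M 0 ≃ₗ[R] L ⊗[R] M :=
  (homologyZeroIso P (of R M)).toLinearEquiv

lemma tensorHomologyZero_naturality (f : M →ₗ[R] N) (z : tensorHomology P.complex M 0) :
    tensorHomologyZero P N (tensorHomologyMap P.complex 0 f z) =
      f.lTensor L (tensorHomologyZero P M z) :=
  LinearMap.congr_fun (congrArg Hom.hom (homologyZeroIso_naturality P (ofHom f))) z

lemma tensorHomologyMap_zero_surjective {f : M →ₗ[R] N} (hf : Function.Surjective f) :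
    Function.Surjective (tensorHomologyMap P.complex 0 f) := by
  intro z
  obtain ⟨w, hw⟩ := LinearMap.lTensor_surjective L hf (tensorHomologyZero P N z)
  refine ⟨(tensorHomologyZero P M).symm w, (tensorHomologyZero P N).injective ?_⟩
  rw [tensorHomologyZero_naturality, LinearEquiv.apply_symm_apply, hw]

/-- The kernel of the map induced in degree `0` is the kernel of the tensor product map. -/
def kerTensorHomologyMapZero (f : M →ₗ[R] N) :
    LinearMap.ker (tensorHomologyMap P.complex 0 f) ≃ₗ[R] LinearMap.ker (f.lTensor L) :=
  (tensorHomologyZero P M).ofSubmodules _ _ (by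
    ext z
    rw [Submodule.mem_map_equiv, LinearMap.mem_ker, LinearMap.mem_ker,
      ← (tensorHomologyZero P N).map_eq_zero_iff, tensorHomologyZero_naturality,
      LinearEquiv.apply_symm_apply])

lemma subsingleton_tensorHomology_succ [Module.Flat R M] (n : ℕ) :
    Subsingleton (tensorHomology P.complex M (n + 1)) :=
  subsingleton_tensorHomology P.complex (P.complex_exactAt_succ n)

variable {A B C : Type u} [AddCommGroup A] [Module R A] [AddCommGroup B] [Module R B]
  [AddCommGroup C] [Module R C] {f : A →ₗ[R] B} {g : B →ₗ[R] C}
  (hf : Function.Injective f) (hfg : Function.Exact f g) (hg : Function.Surjective g)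

include hf hfg hg in
lemma nonempty_tensorHomology_one_equiv [Module.Flat R B] :
    Nonempty (tensorHomology P.complex C 1 ≃ₗ[R]
      LinearMap.ker (tensorHomologyMap P.complex 0 f)) := by
  have := subsingleton_tensorHomology_succ P (M := B) 0
  have hinj : Function.Injective (tensorHomologyδ P.complex hf hfg hg 0) := by
    rw [injective_iff_map_eq_zero]
    intro z hz
    obtain ⟨w, rfl⟩ := (tensorHomology_exact₃ P.complex hf hfg hg 0 z).1 hz
    rw [Subsingleton.elim w 0, map_zero]
  refine ⟨(LinearEquiv.ofInjective _ hinj).trans (LinearEquiv.ofEq _ _ ?_)⟩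
  exact (LinearMap.exact_iff.1 (tensorHomology_exact₁ P.complex hf hfg hg 0)).symm

include hf hfg hg in
lemma nonempty_tensorHomology_succ_equiv [Module.Flat R B] (n : ℕ) :
    Nonempty (tensorHomology P.complex C (n + 2) ≃ₗ[R] tensorHomology P.complex A (n + 1)) := by
  have := subsingleton_tensorHomology_succ P (M := B) n
  have := subsingleton_tensorHomology_succ P (M := B) (n + 1)
  refine ⟨LinearEquiv.ofBijective (tensorHomologyδ P.complex hf hfg hg (n + 1)) ⟨?_, fun z => ?_⟩⟩
  · rw [injective_iff_map_eq_zero]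
    intro z hz
    obtain ⟨w, rfl⟩ := (tensorHomology_exact₃ P.complex hf hfg hg (n + 1) z).1 hz
    rw [Subsingleton.elim w 0, map_zero]
  · exact (tensorHomology_exact₁ P.complex hf hfg hg (n + 1) z).1 (Subsingleton.elim _ _)

lemma nonempty_tensorHomology_equiv_ker (n : ℕ) : ∀ (F : ℕ → Type u) [∀ i, AddCommGroup (F i)]
    [∀ i, Module R (F i)] [∀ i, Module.Flat R (F i)] (d : ∀ i, F (i + 1) →ₗ[R] F i)
    (_ : ∀ i, Function.Exact (d (i + 1)) (d i)) (C : Type u) [AddCommGroup C] [Module R C]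
    (g : F 0 →ₗ[R] C) (_ : Function.Exact (d 0) g) (_ : Function.Surjective g),
    Nonempty (tensorHomology P.complex C (n + 1) ≃ₗ[R]
      LinearMap.ker (tensorHomologyMap P.complex 0 (LinearMap.range (d n)).subtype)) := by
  have hex {A B C : Type u} [AddCommGroup A] [Module R A] [AddCommGroup B] [Module R B]
      [AddCommGroup C] [Module R C] {f : A →ₗ[R] B} {g : B →ₗ[R] C} (h : Function.Exact f g) :
      Function.Exact (LinearMap.range f).subtype g := by
    rw [LinearMap.exact_iff, Submodule.range_subtype, LinearMap.exact_iff.1 h]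
  induction n with
  | zero =>
    intro F _ _ _ d _ C _ _ g hdg hg
    exact nonempty_tensorHomology_one_equiv P (Submodule.injective_subtype _) (hex hdg) hg
  | succ n ih =>
    intro F _ _ _ d hd C _ _ g hdg hg
    obtain ⟨e⟩ := nonempty_tensorHomology_succ_equiv P (Submodule.injective_subtype _)
      (hex hdg) hg n
    have hd₀ : Function.Exact (d 1) (d 0).rangeRestrict := by
      rw [LinearMap.exact_iff, LinearMap.ker_rangeRestrict]
      exact LinearMap.exact_iff.1 (hd 0)
    obtain ⟨e'⟩ := ih (fun i => F (i + 1)) (fun i => d (i + 1)) (fun i => hd (i + 1)) _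
      (d 0).rangeRestrict hd₀ (LinearMap.surjective_rangeRestrict _)
    exact ⟨e.trans e'⟩

lemma nonempty_homology_equiv_ker (S : ShortComplex (ModuleCat.{u} R)) {O : ModuleCat.{u} R}
    (p : S.X₂ ⟶ O) (hp : Function.Surjective p) (hSp : Function.Exact S.f p) (j : O ⟶ S.X₃)
    (hj : p ≫ j = S.g) : Nonempty (S.homology ≃ₗ[R] LinearMap.ker j.hom) := by
  have : Epi p := (epi_iff_surjective _).2 hp
  have h₀ : S.f ≫ p = 0 := by ext x; exact hSp.apply_apply_eq_zero x
  have hS : (ShortComplex.mk S.f p h₀).Exact :=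
    (ShortComplex.ShortExact.moduleCat_exact_iff_function_exact _).2 hSp
  have hdesc : hS.gIsCokernel.desc (CokernelCofork.ofπ S.g S.zero) = j := by
    rw [← cancel_epi p, hj]
    exact hS.gIsCokernel.fac _ WalkingParallelPair.one
  subst hdesc
  let d : S.RightHomologyData :=
    { Q := O
      H := kernel _
      p := p
      ι := kernel.ι _
      wp := h₀
      hp := hS.gIsCokernel
      wι := kernel.condition _
      hι := kernelIsKernel _ }
  exact ⟨(d.homologyIso ≪≫ kernelIsoKer _).toLinearEquiv⟩

variable (L) in
/-- `Tor` can be computed from a projective resolution of the first argument. -/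
lemma nonempty_tor_equiv_tensorHomology (M : Type u) [AddCommGroup M] [Module R M] (n : ℕ) :
    Nonempty ((((Tor (ModuleCat.{u} R) n).obj L).obj (of R M)) ≃ₗ[R]
      tensorHomology P.complex M n) := by
  cases n with
  | zero =>
    exact ⟨(((tensorLeft L).leftDerivedZeroIsoSelf.app (of R M)).toLinearEquiv).trans
      (tensorHomologyZero P M).symm⟩
  | succ n =>
    let P' := CategoryTheory.projectiveResolution (of R M)
    let K := ((tensorLeft L).mapHomologicalComplex _).obj P'.complex
    obtain ⟨e⟩ := nonempty_tensorHomology_equiv_ker P n (fun i => P'.complex.X i)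
      (fun i => (P'.complex.d (i + 1) i).hom)
      (fun i => (ShortComplex.ShortExact.moduleCat_exact_iff_function_exact _).1 (P'.exact_succ i))
      M (augmentation P') (exact_augmentation P') (augmentation_surjective P')
    let d := (P'.complex.d (n + 1) n).hom
    have hd : Function.Exact (P'.complex.d (n + 2) (n + 1)).hom d.rangeRestrict := by
      rw [LinearMap.exact_iff, LinearMap.ker_rangeRestrict]
      exact LinearMap.exact_iff.1
        ((ShortComplex.ShortExact.moduleCat_exact_iff_function_exact _).1 (P'.exact_succ n))
    obtain ⟨e'⟩ := nonempty_homology_equiv_ker (K.sc' (n + 2) (n + 1) n)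
      (O := of R (L ⊗[R] LinearMap.range d)) (ofHom (d.rangeRestrict.lTensor L))
      (LinearMap.lTensor_surjective L d.surjective_rangeRestrict)
      (lTensor_exact L hd d.surjective_rangeRestrict)
      (ofHom ((LinearMap.range d).subtype.lTensor L)) (by
        ext1
        exact (LinearMap.lTensor_comp L _ _).symm)
    have e₁ := (P'.isoLeftDerivedObj (tensorLeft L) (n + 1)).toLinearEquiv
    have e₂ := (ShortComplex.homologyMapIso
      (K.isoSc' (n + 2) (n + 1) n (by simp) (by simp))).toLinearEquiv
    exact ⟨e₁.trans (e₂.trans (e'.trans ((kerTensorHomologyMapZero P _).symm.trans e.symm)))⟩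

end


section

open TensorProduct

variable {L : ModuleCat.{u} R} (P : ProjectiveResolution L)

lemma smul_tensorHomology_eq_zero {r : R} (hr : ∀ l : L, r • l = 0) (n : ℕ) :
    ∀ (M : Type u) [AddCommGroup M] [Module R M] (z : tensorHomology P.complex M n),
      r • z = 0 := by
  have h₀ (M : Type u) [AddCommGroup M] [Module R M] (z : tensorHomology P.complex M 0) :
      r • z = 0 := by
    rw [← (tensorHomologyZero P M).map_eq_zero_iff, map_smul]
    induction tensorHomologyZero P M z using TensorProduct.induction_on with
    | zero => simp
    | tmul l m => rw [TensorProduct.smul_tmul', hr, TensorProduct.zero_tmul]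
    | add a b ha hb => rw [smul_add, ha, hb, add_zero]
  have hex (M : Type u) [AddCommGroup M] [Module R M] :
      Function.Exact (LinearMap.ker (Finsupp.linearCombination R (id : M → M))).subtype
        (Finsupp.linearCombination R (id : M → M)) := by
    rw [LinearMap.exact_iff, Submodule.range_subtype]
  match n with
  | 0 => exact h₀
  | 1 =>
    intro M _ _ z
    obtain ⟨e⟩ := nonempty_tensorHomology_one_equiv P (Submodule.injective_subtype _) (hex M)
      (Finsupp.linearCombination_id_surjective R M)
    rw [← e.map_eq_zero_iff, map_smul]
    exact Subtype.ext (h₀ _ _)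
  | n + 2 =>
    intro M _ _ z
    obtain ⟨e⟩ := nonempty_tensorHomology_succ_equiv P (Submodule.injective_subtype _) (hex M)
      (Finsupp.linearCombination_id_surjective R M) n
    rw [← e.map_eq_zero_iff, map_smul]
    exact smul_tensorHomology_eq_zero hr (n + 1) _ _

variable {M N : Type u} [AddCommGroup M] [Module R M] [AddCommGroup N] [Module R N]

lemma tensorHomologyMap_smul_eq_zero {r : R} (hr : ∀ l : L, r • l = 0) (n : ℕ) (f : M →ₗ[R] N) :
    tensorHomologyMap P.complex n (r • f) = 0 := by
  ext1 z
  rw [tensorHomologyMap_smul]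
  exact smul_tensorHomology_eq_zero P hr n _ _

variable (Q : ChainComplex (ModuleCat.{u} R) ℕ)

lemma tensorHomologyMap_zero (n : ℕ) : tensorHomologyMap Q n (0 : M →ₗ[R] N) = 0 := by
  rw [← zero_smul R (0 : M →ₗ[R] N), tensorHomologyMap_smul, zero_smul]

lemma subsingleton_tensorHomology_of_subsingleton [Subsingleton M] (n : ℕ) :
    Subsingleton (tensorHomology Q M n) := by
  refine subsingleton_of_forall_eq 0 fun z => ?_
  have h := LinearMap.congr_fun (tensorHomologyMap_id Q (M := M) n) z
  rwa [Subsingleton.elim (LinearMap.id : M →ₗ[R] M) 0, tensorHomologyMap_zero, eq_comm] at h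

lemma tensorHomologyMap_inl_add_inr (n : ℕ) (z : tensorHomology Q (M × N) n) :
    tensorHomologyMap Q n (LinearMap.inl R M N) (tensorHomologyMap Q n (LinearMap.fst R M N) z) +
      tensorHomologyMap Q n (LinearMap.inr R M N) (tensorHomologyMap Q n (LinearMap.snd R M N) z) =
      z := by
  have h : LinearMap.inl R M N ∘ₗ LinearMap.fst R M N + LinearMap.inr R M N ∘ₗ LinearMap.snd R M N =
      LinearMap.id := by ext <;> simp
  replace h := congrArg (tensorHomologyMap Q n) h
  rw [tensorHomologyMap_add, tensorHomologyMap_comp, tensorHomologyMap_comp,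
    tensorHomologyMap_id] at h
  exact LinearMap.congr_fun h z

/-- `tensorHomology` commutes with binary products. -/
def tensorHomologyProd (M N : Type u) [AddCommGroup M] [Module R M] [AddCommGroup N] [Module R N]
    (n : ℕ) : tensorHomology Q (M × N) n ≃ₗ[R] tensorHomology Q M n × tensorHomology Q N n :=
  LinearEquiv.ofLinearMap
    ((tensorHomologyMap Q n (LinearMap.fst R M N)).prod
      (tensorHomologyMap Q n (LinearMap.snd R M N)))
    ((tensorHomologyMap Q n (LinearMap.inl R M N)).coprod
      (tensorHomologyMap Q n (LinearMap.inr R M N)))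
    (by
      apply LinearMap.prod_ext <;>
        rw [LinearMap.comp_assoc, LinearMap.prod_comp]
      · rw [LinearMap.coprod_inl, ← tensorHomologyMap_comp, ← tensorHomologyMap_comp,
          LinearMap.fst_comp_inl, LinearMap.snd_comp_inl, tensorHomologyMap_id,
          tensorHomologyMap_zero, LinearMap.id_comp]
        rfl
      · rw [LinearMap.coprod_inr, ← tensorHomologyMap_comp, ← tensorHomologyMap_comp,
          LinearMap.fst_comp_inr, LinearMap.snd_comp_inr, tensorHomologyMap_id,
          tensorHomologyMap_zero, LinearMap.id_comp]
        rfl)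
    (by
      ext1 z
      exact tensorHomologyMap_inl_add_inr Q n z)

end

end ModuleCat

namespace Ideal

open ModuleCat TensorProduct

universe u

variable {R : Type u} [CommRing R]

section IsQuotientFree

variable {M N K : Type*} [AddCommGroup M] [Module R M] [AddCommGroup N] [Module R N]
  [AddCommGroup K] [Module R K] (J : Ideal R)

variable (M) in
/-- An `R`-module is quotient-free for `J` if it is a direct sum of copies of `R ⧸ J`. -/
def IsQuotientFree : Prop := ∃ ι : Type u, Nonempty (M ≃ₗ[R] (ι →₀ R ⧸ J))

namespace IsQuotientFree

variable {J}

lemma of_equiv (h : J.IsQuotientFree M) (e : N ≃ₗ[R] M) : J.IsQuotientFree N := by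
  obtain ⟨ι, ⟨e'⟩⟩ := h
  exact ⟨ι, ⟨e.trans e'⟩⟩

lemma of_subsingleton [Subsingleton M] : J.IsQuotientFree M :=
  ⟨PEmpty, ⟨0, 0, fun _ => Subsingleton.elim _ _, fun _ => Subsingleton.elim _ _⟩⟩

lemma quotient : J.IsQuotientFree (R ⧸ J) :=
  ⟨PUnit, ⟨(Finsupp.uniqueLinearEquiv R (R ⧸ J) PUnit.unit).symm⟩⟩

lemma prod (hM : J.IsQuotientFree M) (hN : J.IsQuotientFree N) : J.IsQuotientFree (M × N) := by
  obtain ⟨ι, ⟨e⟩⟩ := hM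
  obtain ⟨κ, ⟨e'⟩⟩ := hN
  exact ⟨ι ⊕ κ, ⟨(e.prodCongr e').trans (Finsupp.sumFinsuppLEquivProdFinsupp R).symm⟩⟩

lemma of_exact (hM : J.IsQuotientFree M) (hK : J.IsQuotientFree K)
    (hN : ∀ r ∈ J, ∀ z : N, r • z = 0) {f : M →ₗ[R] N} {g : N →ₗ[R] K}
    (hf : Function.Injective f) (hfg : Function.Exact f g) (hg : Function.Surjective g) :
    J.IsQuotientFree N := by
  obtain ⟨ι, ⟨e⟩⟩ := hK
  choose b hb using fun i => hg (e.symm (Finsupp.single i 1))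
  let l : (ι →₀ R ⧸ J) →ₗ[R] N := Finsupp.lsum R fun i =>
    Submodule.liftQ J (LinearMap.toSpanSingleton R N (b i)) fun r hr => by
      simpa using hN r hr (b i)
  have hl : g ∘ₗ (l ∘ₗ e.toLinearMap) = LinearMap.id := by
    suffices h : g ∘ₗ l = e.symm.toLinearMap by
      rw [← LinearMap.comp_assoc, h]
      ext x
      simp
    ext i
    change g (l (Finsupp.single i 1)) = e.symm (Finsupp.single i 1)
    have hone : (1 : R ⧸ J) = Submodule.Quotient.mk 1 := rfl
    rw [← hb i, Finsupp.lsum_single, hone, Submodule.liftQ_apply, LinearMap.toSpanSingleton_apply,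
      one_smul]
  exact (hM.prod ⟨ι, ⟨e⟩⟩).of_equiv (hfg.splitSurjectiveEquiv hf ⟨_, hl⟩).1

lemma eq_zero_of_smul_eq_zero (hM : J.IsQuotientFree M) {y : R}
    (hy : ∀ a : R, y * a ∈ J → a ∈ J) {z : M} (hz : y • z = 0) : z = 0 := by
  obtain ⟨ι, ⟨e⟩⟩ := hM
  rw [← e.map_eq_zero_iff] at hz ⊢
  ext i
  have hi : y • e z i = 0 := by simpa using DFunLike.congr_fun hz i
  obtain ⟨a, ha⟩ := Ideal.Quotient.mk_surjective (e z i)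
  rw [← ha] at hi ⊢
  exact Ideal.Quotient.eq_zero_iff_mem.2 (hy a (Ideal.Quotient.eq_zero_iff_mem.1 hi))

end IsQuotientFree

end IsQuotientFree

section Powers

variable (I : Ideal R)

/-- Multiplication by an element of `I`, as a map `I ^ s → I ^ (s + 1)`. -/
def powMul (r : I) (s : ℕ) : ↥(I ^ s) →ₗ[R] ↥(I ^ (s + 1)) :=
  (LinearMap.lsmul R R r).restrict fun a ha => by
    rw [pow_succ']
    exact Ideal.mul_mem_mul r.2 ha

variable {I} {I' : Ideal R}

lemma pow_succ_le_pow (h : I ≤ I') (s : ℕ) : I ^ (s + 1) ≤ I' ^ s :=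
  (Ideal.pow_right_mono h (s + 1)).trans (Ideal.pow_le_pow_right s.le_succ)

/-- The map `a ↦ (y a, -a)`. -/
def powSyzygy (h : I ≤ I') (y : I') (s : ℕ) :
    ↥(I ^ (s + 1)) →ₗ[R] ↥(I ^ (s + 1)) × ↥(I' ^ s) :=
  ((y : R) • LinearMap.id).prod (-Submodule.inclusion (pow_succ_le_pow h s))

/-- The map `(b, c) ↦ b + y c`. -/
def powGenerate (h : I ≤ I') (y : I') (s : ℕ) :
    ↥(I ^ (s + 1)) × ↥(I' ^ s) →ₗ[R] ↥(I' ^ (s + 1)) :=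
  (Submodule.inclusion (Ideal.pow_right_mono h (s + 1))).coprod (I'.powMul y s)

variable (h : I ≤ I') (y : I')

lemma powGenerate_comp_inl (s : ℕ) : powGenerate h y s ∘ₗ LinearMap.inl R _ _ =
    Submodule.inclusion (Ideal.pow_right_mono h (s + 1)) :=
  LinearMap.coprod_inl _ _

lemma powGenerate_comp_inr (s : ℕ) :
    powGenerate h y s ∘ₗ LinearMap.inr R _ _ = I'.powMul y s :=
  LinearMap.coprod_inr _ _

lemma powSyzygy_injective (s : ℕ) : Function.Injective (powSyzygy h y s) := by
  intro a b hab
  have h₂ := congrArg (fun p => (p.2 : R)) hab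
  exact Subtype.ext (neg_injective h₂)

lemma exact_powSyzygy_powGenerate (hy : ∀ s, ∀ a : R, y * a ∈ I ^ s → a ∈ I ^ s) (s : ℕ) :
    Function.Exact (powSyzygy h y s) (powGenerate h y s) := by
  intro p
  constructor
  · intro hp
    have hp' : (p.1 : R) + y * p.2 = 0 := congrArg Subtype.val hp
    have hmem : (p.2 : R) ∈ I ^ (s + 1) := by
      apply hy
      rw [← neg_eq_of_add_eq_zero_right hp']
      exact neg_mem p.1.2
    refine ⟨-⟨p.2, hmem⟩, Prod.ext (Subtype.ext ?_) (Subtype.ext ?_)⟩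
    · change (y : R) * -(p.2 : R) = p.1
      rw [mul_neg, eq_comm]
      exact eq_neg_of_add_eq_zero_left hp'
    · exact neg_neg (p.2 : R)
  · rintro ⟨a, rfl⟩
    refine Subtype.ext ?_
    change (y : R) * a + y * -(a : R) = 0
    ring

lemma pow_succ_le_sup {J : Ideal R} {y : R} (hJ : J = I ⊔ Ideal.span {y}) (s : ℕ) :
    J ^ (s + 1) ≤ I ^ (s + 1) ⊔ Ideal.span {y} * J ^ s := by
  induction s with
  | zero => simp [hJ]
  | succ s ih =>
    calc J ^ (s + 1 + 1) = I * J ^ (s + 1) ⊔ Ideal.span {y} * J ^ (s + 1) := by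
          rw [pow_succ' J (s + 1), ← Ideal.sup_mul, ← hJ]
      _ ≤ I * (I ^ (s + 1) ⊔ Ideal.span {y} * J ^ s) ⊔ Ideal.span {y} * J ^ (s + 1) :=
          sup_le_sup_right (Ideal.mul_mono_right ih) _
      _ ≤ _ := by
          rw [Ideal.mul_sup, ← pow_succ', sup_assoc]
          refine sup_le_sup_left (sup_le ?_ le_rfl) _
          rw [mul_left_comm, pow_succ' J]
          exact Ideal.mul_mono_right (Ideal.mul_mono_left (hJ ▸ le_sup_left))

lemma powGenerate_surjective (hI' : I' = I ⊔ Ideal.span {(y : R)}) (s : ℕ) :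
    Function.Surjective (powGenerate h y s) := by
  intro z
  obtain ⟨b, hb, c, hc, hbc⟩ := Submodule.mem_sup.1 (pow_succ_le_sup hI' s z.2)
  obtain ⟨c, hc', rfl⟩ := Ideal.mem_span_singleton_mul.1 hc
  exact ⟨(⟨b, hb⟩, ⟨c, hc'⟩), Subtype.ext hbc⟩

variable (I) in
/-- The zeroth power of an ideal is the ring. -/
def powZeroEquiv : ↥(I ^ 0) ≃ₗ[R] R :=
  (LinearEquiv.ofEq _ _ (by rw [pow_zero, Ideal.one_eq_top])).trans Submodule.topEquiv

instance : Module.Flat R ↥(I ^ 0) := Module.Flat.of_linearEquiv I.powZeroEquiv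

end Powers

section

variable {J : Ideal R}

lemma smul_quotient_eq_zero {r : R} (hr : r ∈ J) (l : ModuleCat.of R (R ⧸ J)) : r • l = 0 := by
  obtain ⟨a, rfl⟩ := Ideal.Quotient.mk_surjective l
  exact Ideal.Quotient.eq_zero_iff_mem.2 (J.mul_mem_right a hr)

variable (P : ProjectiveResolution (ModuleCat.of R (R ⧸ J)))

/-- The `R ⧸ J`-homology of the powers of `I` is free over `R ⧸ J`, and in positive powers it is
generated by the images of multiplication by elements of `I`. -/
structure HasFreePowerHomology (I : Ideal R) : Prop where
  free (n s : ℕ) : J.IsQuotientFree (tensorHomology P.complex ↥(I ^ s) n)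
  iSup_range (n s : ℕ) :
    ⨆ r : I, LinearMap.range (tensorHomologyMap P.complex n (I.powMul r (s + 1))) = ⊤

variable {P}

lemma tensorHomologyMap_inclusion_eq_zero {I : Ideal R} (hIJ : I ≤ J)
    (hI : HasFreePowerHomology P I) (n s : ℕ) :
    tensorHomologyMap P.complex n (Submodule.inclusion (pow_succ_le_pow (le_refl I) s)) = 0 := by
  cases s with
  | zero =>
    cases n with
    | zero =>
      have hzero : (Submodule.inclusion (pow_succ_le_pow (le_refl I) 0)).lTensor
          (ModuleCat.of R (R ⧸ J)) = 0 := by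
        ext1
        ext1 l
        ext1 a
        have ha : (a : R) ∈ J := hIJ (by simpa using a.2)
        have h : Submodule.inclusion (pow_succ_le_pow (le_refl I) 0) a =
            (a : R) • (⟨1, by simp⟩ : ↥(I ^ 0)) := Subtype.ext (mul_one _).symm
        change l ⊗ₜ[R] Submodule.inclusion (pow_succ_le_pow (le_refl I) 0) a = 0
        rw [h, TensorProduct.tmul_smul, TensorProduct.smul_tmul', smul_quotient_eq_zero ha,
          TensorProduct.zero_tmul]
      ext1 z
      refine (tensorHomologyZero P _).injective ?_
      rw [tensorHomologyZero_naturality, hzero, LinearMap.zero_apply, LinearMap.zero_apply,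
        map_zero]
    | succ n =>
      have := subsingleton_tensorHomology_succ P (M := ↥(I ^ 0)) n
      ext1 z
      exact Subsingleton.elim _ _
  | succ s =>
    rw [← LinearMap.ker_eq_top, eq_top_iff, ← hI.iSup_range]
    refine iSup_le fun r => ?_
    rw [LinearMap.range_le_ker_iff, ← tensorHomologyMap_comp]
    exact tensorHomologyMap_smul_eq_zero P (smul_quotient_eq_zero (hIJ r.2)) n
      (LinearMap.id : ↥(I ^ (s + 1)) →ₗ[R] _)

lemma isQuotientFree_tensorHomology_pow_zero (I : Ideal R) (n : ℕ) :
    J.IsQuotientFree (tensorHomology P.complex ↥(I ^ 0) n) := by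
  cases n with
  | zero =>
    exact IsQuotientFree.quotient.of_equiv ((tensorHomologyZero P _).trans
      ((TensorProduct.congr (LinearEquiv.refl R (R ⧸ J)) I.powZeroEquiv).trans
        (TensorProduct.rid R _)))
  | succ n =>
    have := subsingleton_tensorHomology_succ P (M := ↥(I ^ 0)) n
    exact .of_subsingleton

lemma hasFreePowerHomology_bot : HasFreePowerHomology P ⊥ := by
  have h (s : ℕ) : Subsingleton ↥((⊥ : Ideal R) ^ (s + 1)) := by
    rw [Ideal.bot_pow s.succ_ne_zero]
    infer_instance
  have h' (n s : ℕ) := subsingleton_tensorHomology_of_subsingleton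
    (M := ↥((⊥ : Ideal R) ^ (s + 1))) P.complex n
  refine ⟨fun n s => ?_, fun n s => Subsingleton.elim _ _⟩
  cases s with
  | zero => exact isQuotientFree_tensorHomology_pow_zero _ _
  | succ s => exact .of_subsingleton

end


namespace HasFreePowerHomology

section

variable {J I I' : Ideal R} {P : ProjectiveResolution (ModuleCat.of R (R ⧸ J))}

lemma tensorHomologyMap_powSyzygy (hI : HasFreePowerHomology P I) (h : I ≤ I') (hI'J : I' ≤ J)
    (y : I') (n s : ℕ) : tensorHomologyMap P.complex n (powSyzygy h y s) = 0 := by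
  have heq : powSyzygy h y s =
      LinearMap.inl R _ _ ∘ₗ ((y : R) • LinearMap.id) +
        (LinearMap.inr R _ _ ∘ₗ (-Submodule.inclusion (Ideal.pow_right_mono h s))) ∘ₗ
          Submodule.inclusion (pow_succ_le_pow (le_refl I) s) := by
    ext1 a
    exact Prod.ext (add_zero _).symm (zero_add _).symm
  rw [heq, tensorHomologyMap_add, tensorHomologyMap_comp, tensorHomologyMap_comp,
    tensorHomologyMap_inclusion_eq_zero (h.trans hI'J) hI,
    tensorHomologyMap_smul_eq_zero P (smul_quotient_eq_zero (hI'J y.2)), LinearMap.comp_zero,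
    LinearMap.comp_zero, add_zero]

variable (hI : HasFreePowerHomology P I) (h : I ≤ I') (hI'J : I' ≤ J) (y : I')
  (hI' : I' = I ⊔ Ideal.span {(y : R)}) (hy : ∀ s, ∀ a : R, y * a ∈ I ^ s → a ∈ I ^ s)

include hI hI'J hI' hy

lemma tensorHomologyMap_powGenerate_injective (n s : ℕ) :
    Function.Injective (tensorHomologyMap P.complex n (powGenerate h y s)) := by
  rw [injective_iff_map_eq_zero]
  intro z hz
  obtain ⟨w, rfl⟩ := (tensorHomology_exact₂ P.complex (powSyzygy_injective h y s)
    (exact_powSyzygy_powGenerate h y hy s) (powGenerate_surjective h y hI' s) n z).1 hz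
  rw [hI.tensorHomologyMap_powSyzygy h hI'J y, LinearMap.zero_apply]

lemma tensorHomologyδ_surjective (n s : ℕ) :
    Function.Surjective (tensorHomologyδ P.complex (powSyzygy_injective h y s)
    (exact_powSyzygy_powGenerate h y hy s) (powGenerate_surjective h y hI' s) n) := fun z =>
  (tensorHomology_exact₁ P.complex (powSyzygy_injective h y s)
    (exact_powSyzygy_powGenerate h y hy s) (powGenerate_surjective h y hI' s) n z).1 (by
      rw [hI.tensorHomologyMap_powSyzygy h hI'J y, LinearMap.zero_apply])

include h in
lemma isQuotientFree_of_eq_sup (n s : ℕ) :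
    J.IsQuotientFree (tensorHomology P.complex ↥(I' ^ s) n) := by
  induction s generalizing n with
  | zero => exact isQuotientFree_tensorHomology_pow_zero _ _
  | succ s ih =>
    have hprod (n : ℕ) := ((hI.free n (s + 1)).prod (ih n)).of_equiv (tensorHomologyProd _ _ _ n)
    cases n with
    | zero =>
      exact (hprod 0).of_equiv (LinearEquiv.ofBijective _
        ⟨hI.tensorHomologyMap_powGenerate_injective h hI'J y hI' hy 0 s,
          tensorHomologyMap_zero_surjective P (powGenerate_surjective h y hI' s)⟩).symm
    | succ n =>
      exact .of_exact (hprod (n + 1)) (hI.free n (s + 1))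
        (fun r hr => smul_tensorHomology_eq_zero P (smul_quotient_eq_zero hr) _ _)
        (hI.tensorHomologyMap_powGenerate_injective h hI'J y hI' hy (n + 1) s)
        (tensorHomology_exact₃ P.complex _ _ _ n)
        (hI.tensorHomologyδ_surjective h hI'J y hI' hy n s)

omit hI'J hI' hy in
lemma range_tensorHomologyMap_inclusion_le (n s : ℕ) :
    LinearMap.range (tensorHomologyMap P.complex n
      (Submodule.inclusion (Ideal.pow_right_mono h (s + 1 + 1)))) ≤
      ⨆ r : I', LinearMap.range (tensorHomologyMap P.complex n (I'.powMul r (s + 1))) := by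
  rw [LinearMap.range_eq_map, ← hI.iSup_range, Submodule.map_iSup]
  refine iSup_le fun r => le_iSup_of_le ⟨r, h r.2⟩ ?_
  have hcomm : I'.powMul ⟨r, h r.2⟩ (s + 1) ∘ₗ
        Submodule.inclusion (Ideal.pow_right_mono h (s + 1)) =
      Submodule.inclusion (Ideal.pow_right_mono h (s + 1 + 1)) ∘ₗ I.powMul r (s + 1) := rfl
  rw [← LinearMap.range_comp, ← tensorHomologyMap_comp, ← hcomm, tensorHomologyMap_comp]
  exact LinearMap.range_comp_le_range _ _

omit hI'J hI' hy in
lemma range_tensorHomologyMap_powGenerate_le (n s : ℕ) :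
    LinearMap.range (tensorHomologyMap P.complex n (powGenerate h y (s + 1))) ≤
      ⨆ r : I', LinearMap.range (tensorHomologyMap P.complex n (I'.powMul r (s + 1))) := by
  rintro _ ⟨z, rfl⟩
  have hinl := tensorHomologyMap_comp P.complex n (powGenerate h y (s + 1)) (LinearMap.inl R _ _)
  have hinr := tensorHomologyMap_comp P.complex n (powGenerate h y (s + 1)) (LinearMap.inr R _ _)
  rw [powGenerate_comp_inl] at hinl
  rw [powGenerate_comp_inr] at hinr
  rw [← tensorHomologyMap_inl_add_inr P.complex n z, map_add]
  refine add_mem (hI.range_tensorHomologyMap_inclusion_le h n s ⟨_, LinearMap.congr_fun hinl _⟩)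
    (Submodule.mem_iSup_of_mem y ⟨_, LinearMap.congr_fun hinr _⟩)

include h in
/-- Freeness passes from `I` to `I + (y)` when `y` is a nonzerodivisor modulo all powers of `I`. -/
lemma of_eq_sup : HasFreePowerHomology P I' := by
  refine ⟨hI.isQuotientFree_of_eq_sup h hI'J y hI' hy, fun n s => ?_⟩
  have hle := hI.range_tensorHomologyMap_powGenerate_le h y n s
  cases n with
  | zero =>
    rwa [LinearMap.range_eq_top.2 (tensorHomologyMap_zero_surjective P
      (powGenerate_surjective h y hI' (s + 1))), top_le_iff] at hle
  | succ n =>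
    rw [eq_top_iff]
    set N := ⨆ r : I', LinearMap.range (tensorHomologyMap P.complex (n + 1) (I'.powMul r (s + 1)))
    let δ (s : ℕ) := tensorHomologyδ P.complex (powSyzygy_injective h y s)
      (exact_powSyzygy_powGenerate h y hy s) (powGenerate_surjective h y hI' s) n
    have hδ : N.map (δ (s + 1)) = ⊤ := by
      rw [eq_top_iff, ← hI.iSup_range]
      refine iSup_le fun r => ?_
      rintro _ ⟨v, rfl⟩
      obtain ⟨w, rfl⟩ := hI.tensorHomologyδ_surjective h hI'J y hI' hy n s v
      refine ⟨tensorHomologyMap P.complex (n + 1) (I'.powMul ⟨r, h r.2⟩ (s + 1)) w,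
        Submodule.mem_iSup_of_mem ⟨r, h r.2⟩ ⟨w, rfl⟩, ?_⟩
      refine (LinearMap.congr_fun (tensorHomologyδ_naturality P.complex _ _ _
        (powSyzygy_injective h y (s + 1)) (exact_powSyzygy_powGenerate h y hy (s + 1))
        (powGenerate_surjective h y hI' (s + 1))
        (I.powMul r (s + 1)) ((I.powMul r (s + 1)).prodMap (I'.powMul ⟨r, h r.2⟩ s))
        (I'.powMul ⟨r, h r.2⟩ (s + 1)) ?_ ?_ n) w).symm
      · ext1 a
        refine Prod.ext (Subtype.ext ?_) (Subtype.ext ?_)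
        · exact mul_left_comm (y : R) r a
        · exact (mul_neg (r : R) a).symm
      · refine LinearMap.ext fun p => Subtype.ext ?_
        change (r : R) * (p.1 : R) + y * (r * p.2) = r * (p.1 + y * p.2)
        ring
    intro z _
    obtain ⟨w, hw, hwz⟩ : δ (s + 1) z ∈ N.map (δ (s + 1)) := hδ ▸ Submodule.mem_top
    rw [← sub_add_cancel z w]
    refine add_mem (hle ((tensorHomology_exact₃ P.complex (powSyzygy_injective h y (s + 1))
      (exact_powSyzygy_powGenerate h y hy (s + 1)) (powGenerate_surjective h y hI' (s + 1)) n
      (z - w)).1 ?_)) hw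
    exact (map_sub (δ (s + 1)) z w).trans (sub_eq_zero.2 hwz.symm)

end

end HasFreePowerHomology

lemma HasFreePowerHomology.mem_pow_of_mul_mem {I : Ideal R}
    {P : ProjectiveResolution (ModuleCat.of R (R ⧸ I))} (hI : HasFreePowerHomology P I) {y : R}
    (hy : ∀ a : R, y * a ∈ I → a ∈ I) (s : ℕ) (a : R) (ha : y * a ∈ I ^ s) : a ∈ I ^ s := by
  induction s with
  | zero => simp
  | succ s ih =>
    replace ih : a ∈ I ^ s := ih (Ideal.pow_le_pow_right s.le_succ ha)
    have hmem (b : R) (hb : b ∈ I ^ s) : b ∈ I ^ (s + 1) ↔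
        (Submodule.Quotient.mk ⟨b, hb⟩ : ↥(I ^ s) ⧸ (I • ⊤ : Submodule R ↥(I ^ s))) = 0 := by
      rw [Submodule.Quotient.mk_eq_zero, Submodule.mem_smul_top_iff, smul_eq_mul, pow_succ']
    rw [hmem a ih]
    rw [hmem (y * a) (Ideal.mul_mem_left _ _ ih)] at ha
    exact ((hI.free 0 s).of_equiv ((TensorProduct.quotTensorEquivQuotSMul _ I).symm.trans
      (tensorHomologyZero P _).symm)).eq_zero_of_smul_eq_zero hy ha

lemma hasFreePowerHomology_ofList {rs : List R} (hrs : RingTheory.Sequence.IsWeaklyRegular R rs)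
    (k : ℕ) (hk : k ≤ rs.length) {J : Ideal R} (hJ : Ideal.ofList (rs.take k) ≤ J)
    (P : ProjectiveResolution (ModuleCat.of R (R ⧸ J))) :
    HasFreePowerHomology P (Ideal.ofList (rs.take k)) := by
  induction k generalizing J with
  | zero =>
    rw [List.take_zero, Ideal.ofList_nil]
    exact hasFreePowerHomology_bot
  | succ k ih =>
    have hk' : k < rs.length := hk
    have hsup : Ideal.ofList (rs.take (k + 1)) =
        Ideal.ofList (rs.take k) ⊔ Ideal.span {rs[k]} := by
      rw [List.take_succ_eq_append_getElem hk', Ideal.ofList_append, Ideal.ofList_singleton]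
    have hle : Ideal.ofList (rs.take k) ≤ Ideal.ofList (rs.take (k + 1)) := hsup ▸ le_sup_left
    have hmem : rs[k] ∈ Ideal.ofList (rs.take (k + 1)) :=
      hsup ▸ Ideal.mem_sup_right (Ideal.mem_span_singleton_self _)
    refine (ih hk'.le (hle.trans hJ) P).of_eq_sup hle hJ ⟨rs[k], hmem⟩ hsup
      ((ih hk'.le le_rfl (CategoryTheory.projectiveResolution _)).mem_pow_of_mul_mem
        fun a ha => ?_)
    have hreg := hrs.regular_mod_prev k hk'
    rw [smul_eq_mul, Ideal.mul_top] at hreg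
    rw [← Ideal.Quotient.eq_zero_iff_mem] at ha ⊢
    exact hreg.right_eq_zero_of_smul ha

end Ideal

theorem statement_6 {R : Type} [CommRing R] {m : ℕ} (hm : 1 ≤ m) (x : Fin m → R)
    (hreg : RingTheory.Sequence.IsRegular R (List.ofFn x))
    (J : Ideal R) (hJ : J = Ideal.span (Set.range x)) (n s : ℕ) :
    ∃ ι : Type, Nonempty
      ((((Tor (ModuleCat.{0} R) n).obj (ModuleCat.of R (R ⧸ J))).obj
          (ModuleCat.of R ↥(J ^ s))) ≃ₗ[R] (ι →₀ R ⧸ J)) := by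
  let P := CategoryTheory.projectiveResolution (ModuleCat.of R (R ⧸ J))
  have hJ' : Ideal.ofList ((List.ofFn x).take (List.ofFn x).length) = J := by
    rw [List.take_length, hJ, Ideal.ofList]
    congr 1
    ext r
    simp
  have hfree := Ideal.hasFreePowerHomology_ofList hreg.toIsWeaklyRegular _ le_rfl hJ'.le P
  rw [hJ'] at hfree
  obtain ⟨e⟩ := ModuleCat.nonempty_tor_equiv_tensorHomology _ P ↥(J ^ s) n
  exact (hfree.free n s).of_equiv e

end
end

section
/- For all n ≥ 0 and all s ≥ 1, Tor_n^R(R/J, R/J^s) is a free module over L = R/J (the L-module structure coming from the first variable). -/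
/-!
Statement 9: for all `n ≥ 0` and `s ≥ 1`, `Tor_n^R(L, R/J^s)` is a free
`L = R/J`-module.  (Freeness over `L` is expressed by an `R`-linear isomorphism with
a direct sum `ι →₀ L` of copies of `L`.)
-/

open CategoryTheory

noncomputable section

universe u

section MinimalResolution

variable {R : Type u} [CommRing R]

/-- A module over `R` has a `J`-minimal free resolution if it lies in a class of modules each of
which is covered by a free module `F` with kernel contained in `J F` and again in the class. -/
def HasMinimalResolution (J : Ideal R) (M : Type u) [AddCommGroup M] [Module R M] : Prop :=
  ∃ P : ModuleCat.{u} R → Prop, P (ModuleCat.of R M) ∧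
    ∀ N, P N → ∃ (F : ModuleCat.{u} R) (p : F →ₗ[R] N), Module.Free R F ∧
      Function.Surjective p ∧ LinearMap.ker p ≤ J • ⊤ ∧ P (ModuleCat.of R (LinearMap.ker p))

namespace HasMinimalResolution

variable {J : Ideal R} {M N : Type u} [AddCommGroup M] [Module R M] [AddCommGroup N] [Module R N]

theorem exists_cover (h : HasMinimalResolution J M) :
    ∃ (F : ModuleCat.{u} R) (p : F →ₗ[R] M), Module.Free R F ∧ Function.Surjective p ∧
      LinearMap.ker p ≤ J • ⊤ ∧ HasMinimalResolution J (LinearMap.ker p) := by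
  obtain ⟨P, hM, hP⟩ := h
  obtain ⟨F, p, hF, hp, hker, hPk⟩ := hP _ hM
  exact ⟨F, p, hF, hp, hker, P, hPk, hP⟩

theorem of_free [Module.Free R M] : HasMinimalResolution J M := by
  refine ⟨fun N => Module.Free R N, ‹_›, fun N hN => ⟨N, LinearMap.id, hN,
    Function.surjective_id, by simp, ?_⟩⟩
  have : Subsingleton (LinearMap.ker (LinearMap.id : N →ₗ[R] N)) := by
    rw [LinearMap.ker_id]; infer_instance
  exact Module.Free.of_subsingleton R _

theorem of_equiv (e : M ≃ₗ[R] N) (h : HasMinimalResolution J N) : HasMinimalResolution J M := by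
  refine ⟨fun A => ∃ B : ModuleCat.{u} R, Nonempty (A ≃ₗ[R] B) ∧ HasMinimalResolution J B,
    ⟨ModuleCat.of R N, ⟨e⟩, h⟩, ?_⟩
  rintro A ⟨B, ⟨f⟩, hB⟩
  obtain ⟨F, p, hF, hp, hker, hk⟩ := hB.exists_cover
  have hkp : LinearMap.ker (f.symm.toLinearMap ∘ₗ p) = LinearMap.ker p := by
    ext x; simp
  refine ⟨F, f.symm.toLinearMap ∘ₗ p, hF, f.symm.surjective.comp hp, hkp ▸ hker,
    ModuleCat.of R (LinearMap.ker p), ⟨LinearEquiv.ofEq _ _ hkp⟩, hk⟩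

theorem finsupp (ι : Type u) (h : HasMinimalResolution J M) : HasMinimalResolution J (ι →₀ M) := by
  refine ⟨fun A => ∃ B : ModuleCat.{u} R, Nonempty (A ≃ₗ[R] (ι →₀ B)) ∧ HasMinimalResolution J B,
    ⟨ModuleCat.of R M, ⟨LinearEquiv.refl _ _⟩, h⟩, ?_⟩
  rintro A ⟨B, ⟨f⟩, hB⟩
  obtain ⟨F, p, hF, hp, hker, hk⟩ := hB.exists_cover
  let q : (ι →₀ F) →ₗ[R] (ι →₀ B) := Finsupp.mapRange.linearMap p
  have hq : LinearMap.ker (f.symm.toLinearMap ∘ₗ q) =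
      LinearMap.range (Finsupp.mapRange.linearMap (α := ι) (LinearMap.ker p).subtype) := by
    rw [LinearMap.ker_comp, LinearEquiv.ker, ← LinearMap.ker, Finsupp.ker_mapRange,
      Finsupp.range_mapRange_linearMap _ (by simp)]
    simp
  refine ⟨ModuleCat.of R (ι →₀ F), f.symm.toLinearMap ∘ₗ q, Module.Free.finsupp _ _ _,
    f.symm.surjective.comp (Finsupp.mapRange_surjective _ (map_zero _) hp), ?_,
    ModuleCat.of R (LinearMap.ker p), ⟨?_⟩, hk⟩
  · rw [hq]
    rintro _ ⟨c, rfl⟩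
    induction c using Finsupp.induction_linear with
    | zero => simp
    | add a b ha hb => rw [map_add]; exact add_mem ha hb
    | single i a =>
      simpa using Submodule.smul_top_le_comap_smul_top J (Finsupp.lsingle (R := R) i)
        (hker a.2)
  · exact (LinearEquiv.ofEq _ _ hq).trans (LinearEquiv.ofInjective _
      (Finsupp.mapRange_injective _ (map_zero _) Subtype.val_injective)).symm

theorem smul_top_prod {F G : Type u} [AddCommGroup F] [Module R F] [AddCommGroup G] [Module R G]
    {a : F} {b : G} (ha : a ∈ J • (⊤ : Submodule R F)) (hb : b ∈ J • (⊤ : Submodule R G)) :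
    (a, b) ∈ J • (⊤ : Submodule R (F × G)) := by
  have h₁ := Submodule.mem_comap.1 (Submodule.smul_top_le_comap_smul_top J (.inl R F G) ha)
  have h₂ := Submodule.mem_comap.1 (Submodule.smul_top_le_comap_smul_top J (.inr R F G) hb)
  simpa using add_mem h₁ h₂

/-- The cokernel of `(α, y g) : A → F × B` has a `J`-minimal resolution (a mapping cone) if `A` and
`B` do, `F` is free, `α` takes values in `J F`, and `y ∈ J`. -/
theorem of_pushout {y : R} (hy : y ∈ J) {A B F C : ModuleCat.{u} R}
    (hA : HasMinimalResolution J A) (hB : HasMinimalResolution J B) [Module.Free R F]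
    (α : A →ₗ[R] F) (hα : ∀ a, α a ∈ J • (⊤ : Submodule R F)) (g : A →ₗ[R] B)
    (q : F × B →ₗ[R] C) (hq : Function.Surjective q)
    (hinj : ∀ a, α a = 0 → y • g a = 0 → a = 0)
    (hker : ∀ z : F × B, q z = 0 ↔ ∃ a, α a = z.1 ∧ y • g a = z.2) :
    HasMinimalResolution J C := by
  refine ⟨fun C => ∃ (A B F : ModuleCat.{u} R) (α : A →ₗ[R] F) (g : A →ₗ[R] B)
    (q : F × B →ₗ[R] C), HasMinimalResolution J A ∧ HasMinimalResolution J B ∧ Module.Free R F ∧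
    (∀ a, α a ∈ J • (⊤ : Submodule R F)) ∧ Function.Surjective q ∧
    (∀ a, α a = 0 → y • g a = 0 → a = 0) ∧
    (∀ z : F × B, q z = 0 ↔ ∃ a, α a = z.1 ∧ y • g a = z.2),
    ⟨A, B, F, α, g, q, hA, hB, ‹_›, hα, hq, hinj, hker⟩, ?_⟩
  clear! A B F C
  rintro C ⟨A, B, F, α, g, q, hA, hB, hF, hα, hq, hinj, hker⟩
  obtain ⟨FA, pA, hFA, hpA, hkA, hrA⟩ := hA.exists_cover
  obtain ⟨FB, pB, hFB, hpB, hkB, hrB⟩ := hB.exists_cover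
  obtain ⟨gL, hgL⟩ := Module.projective_lifting_property pB (g ∘ₗ pA) hpB
  replace hgL : ∀ w, pB (gL w) = g (pA w) := fun w => LinearMap.congr_fun hgL w
  let p : F × FB →ₗ[R] C := q ∘ₗ LinearMap.prodMap LinearMap.id pB
  have hp : ∀ z : F × FB, p z = q (z.1, pB z.2) := fun z => rfl
  have hmem : ∀ z : F × FB, p z = 0 → ∃ (w : FA) (k : LinearMap.ker pB),
      z = (α (pA w), y • gL w + k) := by
    rintro ⟨c, d⟩ hz
    obtain ⟨a, ha₁, ha₂⟩ := (hker _).1 ((hp _).symm.trans hz)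
    obtain ⟨w, rfl⟩ := hpA a
    refine ⟨w, ⟨d - y • gL w, ?_⟩, ?_⟩
    · simp only [LinearMap.mem_ker, map_sub, map_smul, hgL]
      exact sub_eq_zero.2 ha₂.symm
    · simp only at ha₁
      simp [ha₁]
  let r : FA × LinearMap.ker pB →ₗ[R] LinearMap.ker p :=
    LinearMap.codRestrict _ (LinearMap.prod (α ∘ₗ pA ∘ₗ LinearMap.fst R _ _)
      (y • gL ∘ₗ LinearMap.fst R _ _ + (LinearMap.ker pB).subtype ∘ₗ LinearMap.snd R _ _)) <| by
        rintro ⟨w, k⟩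
        refine (hker _).2 ⟨pA w, rfl, ?_⟩
        simp [hgL]
  have hr : ∀ z, (r z : F × FB) = (α (pA z.1), y • gL z.1 + z.2) := fun z => rfl
  refine ⟨ModuleCat.of R (F × FB), p, Module.Free.prod _ _ _, ?_, ?_,
    ModuleCat.of R (LinearMap.ker pA), ModuleCat.of R (LinearMap.ker pB), FA,
    (LinearMap.ker pA).subtype,
    -(gL.restrict (p := LinearMap.ker pA) (q := LinearMap.ker pB) fun w hw => ?_), r, hrA, hrB, hFA,
    fun a => hkA a.2, ?_, ?_, ?_⟩
  · exact hq.comp (Function.surjective_id.prodMap hpB)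
  · intro z hz
    obtain ⟨w, k, rfl⟩ := hmem z hz
    exact smul_top_prod (hα _)
      (add_mem (Submodule.smul_mem_smul hy Submodule.mem_top) (hkB k.2))
  · rw [LinearMap.mem_ker, hgL, LinearMap.mem_ker.1 hw, map_zero]
  · rintro ⟨z, hz⟩
    obtain ⟨w, k, rfl⟩ := hmem z hz
    exact ⟨(w, k), rfl⟩
  · intro a ha _
    exact Subtype.ext ha
  · rintro ⟨w, k⟩
    rw [← Subtype.coe_inj, hr]
    constructor
    · intro h
      obtain ⟨h₁, h₂⟩ := Prod.mk.inj h
      have hw : pA w = 0 := by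
        refine hinj _ h₁ ?_
        have := congrArg pB h₂
        rw [map_add, map_smul, LinearMap.mem_ker.1 k.2, hgL, add_zero, map_zero] at this
        exact this
      refine ⟨⟨w, hw⟩, rfl, Subtype.ext ?_⟩
      simpa [neg_eq_iff_add_eq_zero] using h₂
    · rintro ⟨⟨w', hw'⟩, h₁, h₂⟩
      obtain rfl : w' = w := h₁
      have := congrArg Subtype.val h₂
      ext
      · simp [LinearMap.mem_ker.1 hw']
      · rw [← this]; simp

/-- If `f = y g` is injective with `y ∈ J` and cokernel `C`, then minimal resolutions of
the source and target of `f` give one of `C`. -/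
theorem of_exact {A B C : Type u} [AddCommGroup A] [Module R A] [AddCommGroup B] [Module R B]
    [AddCommGroup C] [Module R C] {y : R} (hy : y ∈ J) (hA : HasMinimalResolution J A)
    (hB : HasMinimalResolution J B) (g : A →ₗ[R] B) (q : B →ₗ[R] C) (hq : Function.Surjective q)
    (hinj : Function.Injective (y • g)) (hex : Function.Exact (y • g) q) :
    HasMinimalResolution J C := by
  refine of_pushout (A := ModuleCat.of R A) (B := ModuleCat.of R B)
    (F := ModuleCat.of R PUnit.{u + 1}) (C := ModuleCat.of R C) hy hA hB 0 (fun _ => zero_mem _) g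
    (q ∘ₗ LinearMap.snd R _ _) (hq.comp Prod.snd_surjective) ?_ ?_
  · intro a _ ha
    exact (injective_iff_map_eq_zero _).1 hinj a ha
  · rintro ⟨_, z⟩
    exact (hex z).trans ⟨fun ⟨a, h⟩ => ⟨a, rfl, h⟩, fun ⟨a, _, h⟩ => ⟨a, h⟩⟩

end HasMinimalResolution
end MinimalResolution

section QuasiRegular

variable {R : Type u} [CommRing R]

/-- The family `b` in `I ^ k` induces a basis of `I ^ k / I ^ (k + 1)` over `R / I`. -/
structure IsGradedBasis (I : Ideal R) (k : ℕ) {ι : Type u} (b : ι → R) : Prop where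
  span_eq : Ideal.span (Set.range b) = I ^ k
  mem_of_sum_mem : ∀ r : ι →₀ R, Finsupp.linearCombination R b r ∈ I ^ (k + 1) → ∀ i, r i ∈ I

/-- Every graded piece `I ^ k / I ^ (k + 1)` is free over `R / I`. -/
def IsGradedFree (I : Ideal R) : Prop :=
  ∀ k, ∃ (ι : Type u) (b : ι → R), IsGradedBasis I k b

theorem IsGradedBasis.exists_eq {I : Ideal R} {k : ℕ} {ι : Type u} {b : ι → R}
    (hb : IsGradedBasis I k b) {a : R} (ha : a ∈ I ^ k) :
    ∃ r : ι →₀ R, Finsupp.linearCombination R b r = a := by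
  rw [← hb.span_eq] at ha
  exact (Finsupp.mem_span_range_iff_exists_finsupp.1 ha)

theorem IsGradedBasis.mem {I : Ideal R} {k : ℕ} {ι : Type u} {b : ι → R}
    (hb : IsGradedBasis I k b) (i : ι) : b i ∈ I ^ k :=
  hb.span_eq ▸ Ideal.subset_span ⟨i, rfl⟩

theorem isGradedFree_bot : IsGradedFree (⊥ : Ideal R) := by
  intro k
  cases k with
  | zero =>
    refine ⟨PUnit, fun _ => 1, by simp, fun r hr i => ?_⟩
    simpa [Finsupp.linearCombination_unique] using hr
  | succ k => exact ⟨PEmpty, PEmpty.elim, by simp, fun _ _ i => i.elim⟩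

/-- An element regular modulo `I` is regular modulo all powers of `I`. -/
theorem IsGradedFree.mem_pow_of_mul_mem {I : Ideal R} (hI : IsGradedFree I) {y : R}
    (hy : ∀ a, y * a ∈ I → a ∈ I) (k : ℕ) {a : R} (ha : y * a ∈ I ^ k) : a ∈ I ^ k := by
  induction k with
  | zero => simp
  | succ k ih =>
    obtain ⟨ι, b, hb⟩ := hI k
    obtain ⟨r, rfl⟩ := hb.exists_eq (ih (Ideal.pow_le_pow_right k.le_succ ha))
    rw [← smul_eq_mul, ← map_smul] at ha
    have hr : ∀ i, r i ∈ I := fun i => hy _ (hb.mem_of_sum_mem _ ha i)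
    rw [Finsupp.linearCombination_apply, pow_succ']
    exact Ideal.sum_mem _ fun i _ => Ideal.mul_mem_mul (hr i) (hb.mem i)

theorem sup_span_pow_succ (I : Ideal R) (y : R) (k : ℕ) :
    (I ⊔ Ideal.span {y}) ^ (k + 1) =
      I ^ (k + 1) ⊔ Ideal.span {y} * (I ⊔ Ideal.span {y}) ^ k := by
  refine le_antisymm ?_ (sup_le (Ideal.pow_right_mono le_sup_left _) ?_)
  · induction k with
    | zero => simp
    | succ k ih =>
      rw [pow_succ', Ideal.sup_mul]
      refine sup_le ?_ le_sup_right
      refine (Ideal.mul_mono_right ih).trans ?_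
      rw [Ideal.mul_sup, ← pow_succ']
      refine sup_le_sup_left ?_ _
      rw [mul_left_comm, pow_succ' _ k]
      exact Ideal.mul_mono_right (Ideal.mul_mono_left le_sup_left)
  · rw [pow_succ']
    exact Ideal.mul_mono_left le_sup_right

theorem sup_span_pow_succ' (I : Ideal R) (y : R) (k : ℕ) :
    (I ⊔ Ideal.span {y}) ^ (k + 1) =
      (I ⊔ Ideal.span {y}) ^ k * I ⊔ Ideal.span {y ^ (k + 1)} := by
  refine le_antisymm ?_ (sup_le ?_ ?_)
  · induction k with
    | zero => simp
    | succ k ih =>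
      rw [pow_succ, Ideal.mul_sup]
      refine sup_le le_sup_left ?_
      refine (Ideal.mul_mono_left ih).trans ?_
      rw [Ideal.sup_mul, Ideal.span_singleton_mul_span_singleton, ← pow_succ]
      refine sup_le_sup_right ?_ _
      rw [mul_right_comm, pow_succ _ k]
      exact Ideal.mul_mono_left (Ideal.mul_mono_right le_sup_right)
  · rw [pow_succ]
    exact Ideal.mul_mono_right le_sup_left
  · rw [Ideal.span_singleton_le_iff_mem]
    exact Ideal.pow_mem_pow (Ideal.mem_sup_right (Ideal.mem_span_singleton_self y)) _

theorem IsGradedFree.mem_sup_pow_of_mul_mem {I : Ideal R} (hI : IsGradedFree I) {y : R}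
    (hy : ∀ a, y * a ∈ I → a ∈ I) (k : ℕ) {a : R}
    (ha : y * a ∈ (I ⊔ Ideal.span {y}) ^ (k + 1)) : a ∈ (I ⊔ Ideal.span {y}) ^ k := by
  rw [sup_span_pow_succ] at ha
  obtain ⟨h, hh, e', he', hsum⟩ := Submodule.mem_sup.1 ha
  obtain ⟨e, he, rfl⟩ := Ideal.mem_span_singleton_mul.1 he'
  have h₁ : a - e ∈ I ^ (k + 1) := hI.mem_pow_of_mul_mem hy _ <| by
    rwa [mul_sub, ← hsum, add_sub_cancel_right]
  have h₂ := Ideal.pow_right_mono (le_sup_left : I ≤ I ⊔ Ideal.span {y}) k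
    (Ideal.pow_le_pow_right k.le_succ h₁)
  simpa using add_mem h₂ he

theorem IsGradedBasis.sup_span {I : Ideal R} (hI : IsGradedFree I) {y : R}
    (hy : ∀ a, y * a ∈ I → a ∈ I) {k : ℕ} {ι κ : Type u} {b : ι → R} {c : κ → R}
    (hb : IsGradedBasis I (k + 1) b) (hc : IsGradedBasis (I ⊔ Ideal.span {y}) k c) :
    IsGradedBasis (I ⊔ Ideal.span {y}) (k + 1) (Sum.elim b fun j => y * c j) := by
  have hyJ : y ∈ I ⊔ Ideal.span {y} := Ideal.mem_sup_right (Ideal.mem_span_singleton_self y)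
  refine ⟨?_, fun r hr => ?_⟩
  · rw [Set.Sum.elim_range, Ideal.span_union, hb.span_eq, sup_span_pow_succ, ← hc.span_eq,
      Ideal.span_mul_span, Set.singleton_mul, ← Set.range_comp]
    rfl
  obtain ⟨⟨u, v⟩, rfl⟩ := Finsupp.sumFinsuppEquivProdFinsupp.symm.surjective r
  have hlc : Finsupp.linearCombination R (Sum.elim b fun j => y * c j)
      (Finsupp.sumFinsuppEquivProdFinsupp.symm (u, v)) =
      Finsupp.linearCombination R b u + y * Finsupp.linearCombination R c v := by
    simp [Finsupp.linearCombination_apply, Finsupp.sum_sumElim, Finsupp.mul_sum, mul_left_comm,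
      Function.comp_def]
  rw [hlc] at hr
  have hu : ∀ i, u i ∈ I ⊔ Ideal.span {y} := by
    rw [sup_span_pow_succ] at hr
    obtain ⟨h, hh, e', he', hsum⟩ := Submodule.mem_sup.1 hr
    obtain ⟨e, he, rfl⟩ := Ideal.mem_span_singleton_mul.1 he'
    have hmem : Finsupp.linearCombination R b u ∈ I ^ (k + 1) := by
      rw [Finsupp.linearCombination_apply]
      exact Ideal.sum_mem _ fun i _ => Ideal.mul_mem_left _ _ (hb.mem i)
    obtain ⟨s, hs⟩ := hb.exists_eq <|
      hI.mem_pow_of_mul_mem hy (k + 1) (a := e - Finsupp.linearCombination R c v) <| by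
        rw [show y * (e - Finsupp.linearCombination R c v) =
          Finsupp.linearCombination R b u - h by linear_combination hsum]
        exact sub_mem hmem (Ideal.pow_le_pow_right (k + 1).le_succ hh)
    intro i
    have hi : u i - y * s i ∈ I := hb.mem_of_sum_mem (u - y • s) (by
      rw [map_sub, map_smul, hs, smul_eq_mul]
      convert hh using 1
      linear_combination -hsum) i
    rw [← sub_add_cancel (u i) (y * s i)]
    exact add_mem (Ideal.mem_sup_left hi) (Ideal.mul_mem_right _ _ hyJ)
  have hv : ∀ j, v j ∈ I ⊔ Ideal.span {y} := by
    refine hc.mem_of_sum_mem v (hI.mem_sup_pow_of_mul_mem hy _ ?_)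
    refine (Submodule.add_mem_iff_right _ ?_).1 hr
    rw [Finsupp.linearCombination_apply, pow_succ']
    exact Ideal.sum_mem _ fun i _ => Ideal.mul_mem_mul (hu i)
      (Ideal.pow_right_mono le_sup_left _ (hb.mem i))
  rintro (i | j)
  · simpa using hu i
  · simpa using hv j

theorem IsGradedFree.sup_span {I : Ideal R} (hI : IsGradedFree I) {y : R}
    (hy : ∀ a, y * a ∈ I → a ∈ I) : IsGradedFree (I ⊔ Ideal.span {y}) := by
  intro k
  induction k with
  | zero =>
    refine ⟨PUnit, fun _ => 1, by simp, fun r hr i => ?_⟩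
    simpa [Finsupp.linearCombination_unique] using hr
  | succ k ih =>
    obtain ⟨ι, b, hb⟩ := hI (k + 1)
    obtain ⟨κ, c, hc⟩ := ih
    exact ⟨_, _, hb.sup_span hI hy hc⟩

end QuasiRegular

section Powers

variable {R : Type u} [CommRing R]

theorem HasMinimalResolution.of_ideal_eq {J I K : Ideal R} (e : I = K)
    (h : HasMinimalResolution J (R ⧸ I)) : HasMinimalResolution J (R ⧸ K) :=
  e ▸ h

/-- The map from a sum of copies of `R / I` to `R / K` sending the `i`-th generator to `c * b i`. -/
def familyHom (I K : Ideal R) {ι : Type u} (b : ι → R) (c : R) (h : ∀ i, ∀ t ∈ I, t * (c * b i) ∈ K) :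
    (ι →₀ R ⧸ I) →ₗ[R] R ⧸ K :=
  Finsupp.lsum R fun i => Submodule.mapQ I K (LinearMap.toSpanSingleton R R (c * b i)) (h i)

theorem familyHom_mapRange (I K : Ideal R) {ι : Type u} (b : ι → R) (c : R)
    (h : ∀ i, ∀ t ∈ I, t * (c * b i) ∈ K) (r : ι →₀ R) :
    familyHom I K b c h (Finsupp.mapRange.linearMap (Submodule.mkQ I) r) =
      Submodule.mkQ K (c * Finsupp.linearCombination R b r) := by
  induction r using Finsupp.induction_linear with
  | zero => simp
  | add r s hr hs => rw [map_add, map_add, map_add, hr, hs, mul_add, map_add]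
  | single i a =>
    simp only [familyHom, Finsupp.mapRange.linearMap_apply, Finsupp.mapRange_single,
      Finsupp.lsum_single, Finsupp.linearCombination_single]
    rw [smul_eq_mul, mul_left_comm]
    rfl

theorem IsGradedFree.hasMinimalResolution_mul {I J : Ideal R} (hI : IsGradedFree I) {y : R}
    (hy : ∀ a, y * a ∈ I → a ∈ I) (hyJ : y ∈ J)
    (hres : ∀ s, HasMinimalResolution J (R ⧸ I ^ s)) (k l : ℕ) :
    HasMinimalResolution J (R ⧸ (I ⊔ Ideal.span {y}) ^ k * I ^ l) := by
  induction k generalizing l with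
  | zero => exact (hres l).of_ideal_eq (by simp)
  | succ k ih =>
    obtain ⟨ι, b, hb⟩ := hI l
    set K := (I ⊔ Ideal.span {y}) ^ k * I ^ (l + 1)
    set K' := (I ⊔ Ideal.span {y}) ^ (k + 1) * I ^ l
    have hK' : K' = K ⊔ Ideal.span {y ^ (k + 1)} * I ^ l := by
      simp only [K', K]
      rw [sup_span_pow_succ', Ideal.sup_mul, mul_assoc, ← pow_succ']
    have hKI : K ≤ I ^ (l + 1) := Ideal.mul_le_right
    have hKK' : K ≤ K' := hK' ▸ le_sup_left
    have hmem : ∀ i, ∀ t ∈ I, t * (y ^ k * b i) ∈ K := by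
      intro i t ht
      rw [mul_left_comm]
      refine Ideal.mul_mem_mul (Ideal.pow_mem_pow
        (Ideal.mem_sup_right (Ideal.mem_span_singleton_self y)) _) ?_
      rw [pow_succ']
      exact Ideal.mul_mem_mul ht (hb.mem i)
    have hg : ∀ r : ι →₀ R, (y • familyHom I K b (y ^ k) hmem)
        (Finsupp.mapRange.linearMap (Submodule.mkQ I) r) =
          Submodule.mkQ K (y ^ (k + 1) * Finsupp.linearCombination R b r) := by
      intro r
      rw [LinearMap.smul_apply, familyHom_mapRange, ← map_smul, smul_eq_mul, ← mul_assoc, pow_succ']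
    have hsurj : Function.Surjective (Finsupp.mapRange.linearMap (α := ι) (Submodule.mkQ I)) :=
      Finsupp.mapRange_surjective _ (map_zero _) (Submodule.mkQ_surjective I)
    have hreg : ∀ n a, y ^ n * a ∈ I ^ (l + 1) → a ∈ I ^ (l + 1) := by
      intro n a
      induction n with
      | zero => simp
      | succ n ihn =>
        intro h
        rw [pow_succ' y, mul_assoc] at h
        exact ihn (hI.mem_pow_of_mul_mem hy _ h)
    refine HasMinimalResolution.of_exact hyJ (A := ι →₀ R ⧸ I) (B := R ⧸ K)
      (.finsupp ι ((hres 1).of_ideal_eq (pow_one I))) (ih (l + 1)) (familyHom I K b (y ^ k) hmem)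
      (Submodule.factor hKK') (Submodule.factor_surjective hKK') ?_ ?_
    · refine (injective_iff_map_eq_zero _).2 fun z hz => ?_
      obtain ⟨r, rfl⟩ := hsurj z
      rw [hg, Submodule.mkQ_apply, Submodule.Quotient.mk_eq_zero] at hz
      ext i
      simpa [Ideal.Quotient.eq_zero_iff_mem] using hb.mem_of_sum_mem r (hreg _ _ (hKI hz)) i
    · intro z
      obtain ⟨a, rfl⟩ := Submodule.mkQ_surjective K z
      have ha : Submodule.factor hKK' (Submodule.mkQ K a) = 0 ↔ a ∈ K' := by
        simp [Ideal.Quotient.eq_zero_iff_mem]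
      refine ha.trans ⟨fun h => ?_, ?_⟩
      · rw [hK'] at h
        obtain ⟨u, hu, v, hv, rfl⟩ := Submodule.mem_sup.1 h
        obtain ⟨w, hw, rfl⟩ := Ideal.mem_span_singleton_mul.1 hv
        obtain ⟨r, rfl⟩ := hb.exists_eq hw
        refine ⟨Finsupp.mapRange.linearMap (Submodule.mkQ I) r, ?_⟩
        rw [hg, map_add, Submodule.mkQ_apply K u, (Submodule.Quotient.mk_eq_zero K).2 hu, zero_add]
      · rintro ⟨x, hx⟩
        obtain ⟨r, rfl⟩ := hsurj x
        rw [hg] at hx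
        have hmem' : y ^ (k + 1) * Finsupp.linearCombination R b r ∈ K' := by
          rw [hK', Finsupp.linearCombination_apply]
          exact Ideal.mem_sup_right (Ideal.mul_mem_mul (Ideal.mem_span_singleton_self _)
            (Ideal.sum_mem _ fun i _ => Ideal.mul_mem_left _ _ (hb.mem i)))
        rw [← sub_add_cancel a (y ^ (k + 1) * Finsupp.linearCombination R b r)]
        exact add_mem (hKK' ((Submodule.Quotient.eq K).1 hx.symm)) hmem'

theorem hasMinimalResolution_pow_of_isWeaklyRegular {l : List R}
    (hl : RingTheory.Sequence.IsWeaklyRegular R l) :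
    ∀ n ≤ l.length, IsGradedFree (Ideal.ofList (l.take n)) ∧
      ∀ s, HasMinimalResolution (Ideal.ofList l) (R ⧸ Ideal.ofList (l.take n) ^ s) := by
  intro n
  induction n with
  | zero =>
    intro _
    have h₀ : Ideal.ofList (l.take 0) = ⊥ := Ideal.ofList_nil
    rw [h₀]
    refine ⟨isGradedFree_bot, fun s => ?_⟩
    have : Module.Free R (R ⧸ (⊥ : Ideal R) ^ s) := by
      cases s with
      | zero =>
        have : Subsingleton (R ⧸ (⊥ : Ideal R) ^ 0) := by
          rw [pow_zero, Ideal.one_eq_top]; infer_instance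
        infer_instance
      | succ s =>
        rw [Ideal.bot_pow s.succ_ne_zero]
        exact Module.Free.of_equiv (Submodule.quotEquivOfEqBot (⊥ : Ideal R) rfl).symm
    exact .of_free
  | succ n ih =>
    intro hn
    obtain ⟨h₁, h₂⟩ := ih (Nat.le_of_succ_le hn)
    have hy : ∀ a, l[n] * a ∈ Ideal.ofList (l.take n) → a ∈ Ideal.ofList (l.take n) := by
      intro a ha
      have := hl.regular_mod_prev n hn
      rw [smul_eq_mul, Ideal.mul_top] at this
      exact mem_of_isSMulRegular_quotient_of_smul_mem this ha
    rw [List.take_succ_eq_append_getElem hn, Ideal.ofList_append, Ideal.ofList_singleton]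
    exact ⟨h₁.sup_span hy, fun s =>
      (h₁.hasMinimalResolution_mul hy (Ideal.subset_span (List.getElem_mem hn)) h₂ s 0).of_ideal_eq
        (by simp)⟩

end Powers

section Tor

open scoped TensorProduct

variable {R : Type u} [CommRing R]

/-- A module with a `J`-minimal resolution has a projective resolution by free modules whose
differentials take values in `J` times the next term. -/
theorem HasMinimalResolution.exists_projectiveResolution {J : Ideal R} {M : ModuleCat.{u} R}
    (h : HasMinimalResolution J M) :
    ∃ P : ProjectiveResolution M, (∀ n, Module.Free R (P.complex.X n)) ∧
      ∀ n x, (P.complex.d (n + 1) n).hom x ∈ J • (⊤ : Submodule R (P.complex.X n)) := by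
  let T := {N : ModuleCat.{u} R // HasMinimalResolution J N}
  choose F p hF hp hker hres using fun N : T => N.2.exists_cover
  let S : ℕ → T := fun n => Nat.rec ⟨M, h⟩
    (fun _ N => ⟨ModuleCat.of R (LinearMap.ker (p N)), hres N⟩) n
  let d : ∀ n, F (S (n + 1)) ⟶ F (S n) := fun n =>
    ModuleCat.ofHom ((LinearMap.ker (p (S n))).subtype ∘ₗ p (S (n + 1)))
  have hd : ∀ n x, (d n).hom x = ((p (S (n + 1)) x : LinearMap.ker (p (S n))) : F (S n)) :=
    fun n x => rfl
  have hd_zero : ∀ n x, (d n).hom x = 0 ↔ p (S (n + 1)) x = 0 := fun n x => by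
    rw [hd]; exact Submodule.coe_eq_zero
  have hd_range : ∀ n x, p (S n) x = 0 → ∃ w, (d n).hom w = x := fun n x hx => by
    obtain ⟨w, hw⟩ := hp (S (n + 1)) (⟨x, hx⟩ : LinearMap.ker (p (S n)))
    exact ⟨w, congrArg Subtype.val hw⟩
  have hpd : ∀ n x, p (S n) ((d n).hom x) = 0 := fun n x =>
    (p (S (n + 1)) x : LinearMap.ker (p (S n))).2
  have hdd : ∀ n, d (n + 1) ≫ d n = 0 := fun n => by
    ext x
    exact (hd_zero n _).2 (hpd (n + 1) x)
  let C : ChainComplex (ModuleCat.{u} R) ℕ := ChainComplex.of (fun n => F (S n)) d hdd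
  have hCd : ∀ n, C.d (n + 1) n = d n := fun n => ChainComplex.of_d (fun n => F (S n)) d n
  have hCp : C.d 1 0 ≫ (ModuleCat.ofHom (p (S 0)) : C.X 0 ⟶ M) = 0 := by
    rw [hCd]; ext x; exact hpd 0 x
  let π : C ⟶ (ChainComplex.single₀ _).obj M := (ChainComplex.toSingle₀Equiv _ _).symm
    ⟨ModuleCat.ofHom (p (S 0)), hCp⟩
  have hproj : ∀ n, Projective (C.X n) := fun n =>
    ModuleCat.projective_of_free (Module.Free.chooseBasis R (F (S n)))
  refine ⟨{ complex := C, projective := hproj, π := π, quasiIso := ⟨fun n => ?_⟩ },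
    fun n => hF (S n), fun n x => ?_⟩
  · cases n with
    | zero =>
      rw [ChainComplex.quasiIsoAt₀_iff, ShortComplex.quasiIso_iff_of_zeros']
      · refine (ShortComplex.exact_and_epi_g_iff_of_iso (S₂ := ShortComplex.mk (C.d 1 0)
          (ModuleCat.ofHom (p (S 0)) : C.X 0 ⟶ M) hCp) ?_).2 ⟨?_, ?_⟩
        · refine ShortComplex.isoMk (Iso.refl _) (Iso.refl _) (Iso.refl _)
            ((Category.id_comp _).trans (Category.comp_id _).symm)
            ((Category.id_comp _).trans (Eq.trans ?_ (Category.comp_id _).symm))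
          exact ChainComplex.toSingle₀Equiv_symm_apply_f_zero (C := C) (X := M) _ hCp
        · rw [ShortComplex.moduleCat_exact_iff]
          intro x hx
          change ∃ w, (C.d 1 0).hom w = x
          rw [hCd]
          exact hd_range 0 x hx
        · exact (ModuleCat.epi_iff_surjective _).2 (hp (S 0))
      · exact C.shape 0 0 (by simp)
      · rfl
      · rfl
    | succ n =>
      rw [quasiIsoAt_iff_exactAt' _ _ (ChainComplex.exactAt_succ_single_obj _ _),
        HomologicalComplex.exactAt_iff' _ (n + 2) (n + 1) n (by simp) (by simp),
        ShortComplex.moduleCat_exact_iff]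
      intro x hx
      change (C.d (n + 1) n).hom x = 0 at hx
      change ∃ w, (C.d (n + 2) (n + 1)).hom w = x
      rw [hCd] at hx ⊢
      exact hd_range (n + 1) x ((hd_zero n x).1 hx)
  · have hmem : ∀ g : F (S (n + 1)) ⟶ F (S n), g = d n →
        g.hom x ∈ J • (⊤ : Submodule R (F (S n))) := by
      rintro _ rfl
      exact hker (S n) (hpd n x)
    exact hmem (C.d (n + 1) n) (hCd n)

theorem map_tensorLeft_quotient_eq_zero {J : Ideal R} {A B : ModuleCat.{u} R} {f : A ⟶ B}
    (hf : ∀ x, f.hom x ∈ J • (⊤ : Submodule R B)) :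
    (MonoidalCategory.tensorLeft (ModuleCat.of R (R ⧸ J))).map f = 0 := by
  have key : ∀ (l : R ⧸ J), ∀ z ∈ J • (⊤ : Submodule R B), (l ⊗ₜ[R] z : (R ⧸ J) ⊗[R] B) = 0 := by
    intro l z hz
    induction hz using Submodule.smul_induction_on' with
    | smul r hr y _ =>
      obtain ⟨a, rfl⟩ := Ideal.Quotient.mk_surjective l
      rw [← TensorProduct.smul_tmul]
      have : r • Ideal.Quotient.mk J a = 0 :=
        Ideal.Quotient.eq_zero_iff_mem.2 (Ideal.mul_mem_right a J hr)
      rw [this, TensorProduct.zero_tmul]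
    | add x _ y _ hx hy => rw [TensorProduct.tmul_add, hx, hy, add_zero]
  refine ModuleCat.hom_ext (TensorProduct.ext' fun l x => ?_)
  exact key l _ (hf x)

theorem HasMinimalResolution.exists_tor_equiv {J : Ideal R} {M : ModuleCat.{u} R}
    (h : HasMinimalResolution J M) (n : ℕ) :
    ∃ ι : Type u, Nonempty ((((Tor (ModuleCat.{u} R) n).obj (ModuleCat.of R (R ⧸ J))).obj M) ≃ₗ[R]
      (ι →₀ R ⧸ J)) := by
  obtain ⟨P, hfree, hmin⟩ := h.exists_projectiveResolution
  let F := MonoidalCategory.tensorLeft (ModuleCat.of R (R ⧸ J))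
  let C := (F.mapHomologicalComplex _).obj P.complex
  have hzero : ∀ i j, C.d i j = 0 := by
    intro i j
    by_cases hij : j + 1 = i
    · subst hij
      exact map_tensorLeft_quotient_eq_zero (hmin j)
    · exact C.shape i j hij
  let e₁ : ((Tor (ModuleCat.{u} R) n).obj (ModuleCat.of R (R ⧸ J))).obj M ≅ C.homology n :=
    P.isoLeftDerivedObj F n
  let e₂ : C.homology n ≅ C.X n :=
    (ShortComplex.HomologyData.ofZeros (C.sc n) (hzero _ _) (hzero _ _)).left.homologyIso
  let e₃ : C.X n ≃ₗ[R] (Module.Free.ChooseBasisIndex R (P.complex.X n) →₀ R ⧸ J) := by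
    let b := (Module.Free.chooseBasis R (P.complex.X n)).repr
    exact (TensorProduct.congr (LinearEquiv.refl R (R ⧸ J)) b).trans
      (TensorProduct.finsuppScalarRight R R (R ⧸ J) _)
  exact ⟨_, ⟨(e₁ ≪≫ e₂).toLinearEquiv.trans e₃⟩⟩

end Tor

theorem statement_9 {R : Type} [CommRing R] {m : ℕ} (hm : 1 ≤ m) (x : Fin m → R)
    (hreg : RingTheory.Sequence.IsRegular R (List.ofFn x))
    (J : Ideal R) (hJ : J = Ideal.span (Set.range x)) (n s : ℕ) (hs : 1 ≤ s) :
    ∃ ι : Type, Nonempty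
      ((((Tor (ModuleCat.{0} R) n).obj (ModuleCat.of R (R ⧸ J))).obj
          (ModuleCat.of R (R ⧸ (J ^ s : Ideal R)))) ≃ₗ[R] (ι →₀ R ⧸ J)) := by
  have hJ' : J = Ideal.ofList (List.ofFn x) := by
    rw [hJ]
    congr 1
    ext a
    simp
  have h := (hasMinimalResolution_pow_of_isWeaklyRegular hreg.toIsWeaklyRegular _ le_rfl).2 s
  rw [List.take_length, ← hJ'] at h
  exact HasMinimalResolution.exists_tor_equiv (M := ModuleCat.of R (R ⧸ J ^ s)) h n

end
end

section
/- Let T be an R-module on which x_1, …, x_m is also a regular sequence, i.e. each x_i is a nonzerodivisor on T/(x_1,…,x_{i-1})T and T ≠ JT. Then for every s ≥ 0 the map T ⊗_R J^s → T induced by the inclusion J^s ⊆ R is injective with image the submodule J^s T; consequently the natural maps give isomorphisms T ⊗_R J^s ≅ J^s T and T ⊗_R (J^s/J^{s+1}) ≅ J^s T / J^{s+1} T. -/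
/-!
Statement 12: let `T` be an `R`-module on which the regular sequence `x₁, …, xₘ` is
also regular.  For every `s ≥ 0`, the map `T ⊗_R J^s → T` induced by the inclusion
`J^s ⊆ R` is injective with image `J^s T`; consequently the natural maps give
isomorphisms `T ⊗_R J^s ≅ J^s T` and `T ⊗_R (J^s/J^{s+1}) ≅ J^s T / J^{s+1} T`.
-/

open CategoryTheory TensorProduct

noncomputable section

/-- `J^s/J^{s+1}`, as a module. -/
abbrev IadicGr {R : Type} [CommRing R] (J : Ideal R) (s : ℕ) : Type :=
  ↥(J ^ s) ⧸ (Submodule.comap (J ^ s).subtype (J ^ (s + 1)))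

/-- The map `T ⊗_R J^s → T` induced by the inclusion `J^s ⊆ R`. -/
def smulMap {R : Type} [CommRing R] (T : Type) [AddCommGroup T] [Module R T]
    (J : Ideal R) (s : ℕ) : (T ⊗[R] ↥(J ^ s)) →ₗ[R] T :=
  TensorProduct.lift (((LinearMap.lsmul R T).comp (J ^ s : Ideal R).subtype).flip)

section RegularPowers

variable {R : Type} [CommRing R] {T : Type} [AddCommGroup T] [Module R T]

open scoped Pointwise

theorem sup_span_singleton_pow_succ (J : Ideal R) (x : R) (s : ℕ) :
    (J ⊔ Ideal.span {x}) ^ (s + 1) =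
      J ^ (s + 1) ⊔ Ideal.span {x} * (J ⊔ Ideal.span {x}) ^ s := by
  apply le_antisymm
  · induction s with
    | zero => simp
    | succ s ih =>
      rw [pow_succ' _ (s + 1), Ideal.sup_mul]
      refine sup_le ((Ideal.mul_mono_right ih).trans ?_) le_sup_right
      rw [Ideal.mul_sup, ← pow_succ']
      refine sup_le_sup le_rfl ?_
      rw [mul_left_comm, pow_succ' _ s]
      exact Ideal.mul_mono_right (Ideal.mul_mono_left le_sup_left)
  · refine sup_le (Ideal.pow_right_mono le_sup_left _) ?_
    rw [pow_succ']
    exact Ideal.mul_mono_left le_sup_right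

theorem mem_sup_span_singleton_pow_succ_smul {J : Ideal R} {x : R} {s : ℕ}
    {N : Submodule R T} {t : T} :
    t ∈ (J ⊔ Ideal.span {x}) ^ (s + 1) • N ↔
      ∃ a ∈ J ^ (s + 1) • N, ∃ b ∈ (J ⊔ Ideal.span {x}) ^ s • N, a + x • b = t := by
  rw [sup_span_singleton_pow_succ, Submodule.sup_smul, Submodule.mul_smul,
    Submodule.ideal_span_singleton_smul, Submodule.mem_sup]
  simp [Submodule.mem_smul_pointwise_iff_exists]

/-- A form of quasi-regularity of `J` on `T`, in terms of submodules `N ⊇ JT` only: an element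
which is a nonzerodivisor on `T/N` is one on `J^s T/J^s N`. -/
def PreservesRegularity (T : Type) [AddCommGroup T] [Module R T] (J : Ideal R) : Prop :=
  ∀ (s : ℕ) (N : Submodule R T) (y : R), J • ⊤ ≤ N → (∀ t : T, y • t ∈ N → t ∈ N) →
    ∀ a ∈ (J ^ s • ⊤ : Submodule R T), y • a ∈ J ^ s • N → a ∈ J ^ s • N

namespace PreservesRegularity

variable {J : Ideal R}

theorem bot : PreservesRegularity T (⊥ : Ideal R) := by
  intro s N y _ hy a ha hya
  cases s with
  | zero => simpa using hy a (by simpa using hya)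
  | succ s =>
    obtain rfl : a = 0 := by simpa [pow_succ] using ha
    exact zero_mem _

theorem mem_pow_smul_top (hJ : PreservesRegularity T J) {y : R}
    (hy : ∀ t : T, y • t ∈ (J • ⊤ : Submodule R T) → t ∈ (J • ⊤ : Submodule R T))
    (s : ℕ) {t : T} (ht : y • t ∈ (J ^ s • ⊤ : Submodule R T)) :
    t ∈ (J ^ s • ⊤ : Submodule R T) := by
  induction s with
  | zero => simp
  | succ s ih =>
    have h := hJ s (J • ⊤) y le_rfl hy t
    rw [← Submodule.mul_smul, ← pow_succ] at h
    exact h (ih (Submodule.smul_mono_left (Ideal.pow_le_pow_right s.le_succ) ht)) ht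

theorem sup_span_singleton (hJ : PreservesRegularity T J) {x : R}
    (hx : ∀ t : T, x • t ∈ (J • ⊤ : Submodule R T) → t ∈ (J • ⊤ : Submodule R T)) :
    PreservesRegularity T (J ⊔ Ideal.span {x}) := by
  intro s N y hN hy
  induction s with
  | zero => simpa using fun a => hy a
  | succ s ih =>
    intro a ha hya
    have hJN : (J • ⊤ : Submodule R T) ≤ N := (Submodule.smul_mono_left le_sup_left).trans hN
    have hxN (t : T) : x • t ∈ N := hN <| Submodule.smul_mem_smul
      (Ideal.mem_sup_right (Ideal.mem_span_singleton_self x)) Submodule.mem_top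
    obtain ⟨a', ha', b, hb, rfl⟩ := mem_sup_span_singleton_pow_succ_smul.mp ha
    obtain ⟨c, hc, d, hd, hcd⟩ := mem_sup_span_singleton_pow_succ_smul.mp hya
    have hx_diff : x • (d - y • b) = y • a' - c := by
      rw [smul_sub, sub_eq_sub_iff_add_eq_add, add_comm, hcd, smul_add, smul_comm x y]
    have hdiff : d - y • b ∈ (J ^ (s + 1) • ⊤ : Submodule R T) := by
      refine hJ.mem_pow_smul_top hx _ ?_
      rw [hx_diff]
      exact sub_mem (Submodule.smul_mem _ _ ha') (Submodule.smul_mono le_rfl le_top hc)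
    have hdiffN : d - y • b ∈ (J ⊔ Ideal.span {x}) ^ s • N := by
      rw [pow_succ, Submodule.mul_smul] at hdiff
      exact Submodule.smul_mono (Ideal.pow_right_mono le_sup_left s) hJN hdiff
    have hyb : y • b ∈ (J ⊔ Ideal.span {x}) ^ s • N := by
      simpa using sub_mem hd hdiffN
    refine mem_sup_span_singleton_pow_succ_smul.mpr ⟨a', ?_, b, ih b hb hyb, rfl⟩
    refine hJ (s + 1) N y hJN hy a' ha' ?_
    rw [← sub_add_cancel (y • a') c, ← hx_diff]
    refine add_mem ?_ hc
    refine Submodule.smul_induction_on hdiff (fun r hr t _ => ?_) (fun t u ht hu => ?_)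
    · rw [smul_comm]
      exact Submodule.smul_mem_smul hr (hxN t)
    · rw [smul_add]
      exact add_mem ht hu

end PreservesRegularity

theorem smulMap_tmul (J : Ideal R) (s : ℕ) (t : T) (j : ↥(J ^ s)) :
    smulMap T J s (t ⊗ₜ j) = (j : R) • t := rfl

theorem range_smulMap (J : Ideal R) (s : ℕ) :
    LinearMap.range (smulMap T J s) = (J ^ s • ⊤ : Submodule R T) := by
  apply le_antisymm
  · rintro _ ⟨z, rfl⟩
    induction z with
    | zero => simp
    | tmul t j => exact Submodule.smul_mem_smul j.2 Submodule.mem_top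
    | add z w hz hw => simpa using add_mem hz hw
  · exact Submodule.smul_le.mpr fun r hr t _ => ⟨t ⊗ₜ ⟨r, hr⟩, rfl⟩

theorem smulMap_comp_lTensor_inclusion {I J : Ideal R} {s r : ℕ} (h : I ^ s ≤ J ^ r) :
    smulMap T J r ∘ₗ (Submodule.inclusion h).lTensor T = smulMap T I s :=
  TensorProduct.ext' fun _ _ => rfl

theorem smulMap_zero_injective (J : Ideal R) : Function.Injective (smulMap T J 0) := by
  have hJ : J ^ 0 = (⊤ : Ideal R) := by simp
  let e : (T ⊗[R] ↥(J ^ 0)) ≃ₗ[R] T :=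
    (LinearEquiv.ofTop _ hJ).lTensor T ≪≫ₗ TensorProduct.rid R T
  have he : smulMap T J 0 = e := TensorProduct.ext' fun _ _ => rfl
  rw [he]
  exact e.injective

theorem smulMap_bot_injective (s : ℕ) : Function.Injective (smulMap T (⊥ : Ideal R) s) := by
  cases s with
  | zero => exact smulMap_zero_injective ⊥
  | succ s =>
    have : Subsingleton ↥((⊥ : Ideal R) ^ (s + 1)) := by
      rw [pow_succ, Ideal.mul_bot]
      infer_instance
    exact Function.injective_of_subsingleton _

/-- Multiplication by `x ∈ J`, as a map `J^s → J^{s+1}`. -/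
def mulPow (J : Ideal R) {x : R} (hx : x ∈ J) (s : ℕ) : ↥(J ^ s) →ₗ[R] ↥(J ^ (s + 1)) :=
  (LinearMap.lsmul R R x).restrict fun _ hj => pow_succ' J s ▸ Ideal.mul_mem_mul hx hj

theorem smulMap_lTensor_mulPow {J : Ideal R} {x : R} (hx : x ∈ J) (s : ℕ)
    (z : T ⊗[R] ↥(J ^ s)) :
    smulMap T J (s + 1) ((mulPow J hx s).lTensor T z) = x • smulMap T J s z := by
  refine LinearMap.congr_fun (f := smulMap T J (s + 1) ∘ₗ (mulPow J hx s).lTensor T)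
    (g := x • smulMap T J s) (TensorProduct.ext' fun t j => ?_) z
  exact mul_smul x (j : R) t

theorem smulMap_sup_span_singleton_injective {J : Ideal R} {x : R}
    (hJ : PreservesRegularity T J)
    (hx : ∀ t : T, x • t ∈ (J • ⊤ : Submodule R T) → t ∈ (J • ⊤ : Submodule R T))
    (hinj : ∀ s, Function.Injective (smulMap T J s)) (s : ℕ) :
    Function.Injective (smulMap T (J ⊔ Ideal.span {x}) s) := by
  induction s with
  | zero => exact smulMap_zero_injective _
  | succ s ih =>
    set K := J ⊔ Ideal.span {x} with hK
    have hxK : x ∈ K := Ideal.mem_sup_right (Ideal.mem_span_singleton_self x)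
    have hle (r : ℕ) : J ^ r ≤ K ^ r := Ideal.pow_right_mono le_sup_left r
    have hle' : J ^ (s + 1) ≤ K ^ s := (Ideal.pow_le_pow_right s.le_succ).trans (hle s)
    let i := (Submodule.inclusion (hle (s + 1))).lTensor T
    let μ := (mulPow K hxK s).lTensor T
    have hdecomp (z : T ⊗[R] ↥(K ^ (s + 1))) : ∃ a b, z = i a + μ b := by
      induction z with
      | zero => exact ⟨0, 0, by simp⟩
      | tmul t j =>
        obtain ⟨j, hj⟩ := j
        have hj' := hj
        rw [hK, sup_span_singleton_pow_succ, Submodule.mem_sup] at hj'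
        obtain ⟨p, hp, q, hq, rfl⟩ := hj'
        obtain ⟨r, hr, rfl⟩ := Ideal.mem_span_singleton_mul.mp hq
        refine ⟨t ⊗ₜ ⟨p, hp⟩, t ⊗ₜ ⟨r, hr⟩, ?_⟩
        simp only [i, μ, LinearMap.lTensor_tmul, ← TensorProduct.tmul_add]
        rfl
      | add z w hz hw =>
        obtain ⟨a, b, rfl⟩ := hz
        obtain ⟨c, d, rfl⟩ := hw
        exact ⟨a + c, b + d, by simp only [map_add]; abel⟩
    rw [injective_iff_map_eq_zero]
    intro z hz
    obtain ⟨a, b, rfl⟩ := hdecomp z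
    have hi (w : T ⊗[R] ↥(J ^ (s + 1))) : smulMap T K (s + 1) (i w) = smulMap T J (s + 1) w :=
      LinearMap.congr_fun (smulMap_comp_lTensor_inclusion _) w
    have hxb : x • smulMap T K s b = - smulMap T J (s + 1) a := by
      rw [map_add, hi, smulMap_lTensor_mulPow] at hz
      exact eq_neg_of_add_eq_zero_right hz
    have hb : smulMap T K s b ∈ (J ^ (s + 1) • ⊤ : Submodule R T) := by
      refine hJ.mem_pow_smul_top hx _ ?_
      rw [hxb, ← range_smulMap]
      exact neg_mem ⟨a, rfl⟩
    rw [← range_smulMap] at hb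
    obtain ⟨c, hc⟩ := hb
    obtain rfl : (Submodule.inclusion hle').lTensor T c = b :=
      ih ((LinearMap.congr_fun (smulMap_comp_lTensor_inclusion hle') c).trans hc)
    have hμ : μ ((Submodule.inclusion hle').lTensor T c) = i (x • c) := by
      refine LinearMap.congr_fun (f := μ ∘ₗ (Submodule.inclusion hle').lTensor T)
        (g := i ∘ₗ (x • LinearMap.id)) (TensorProduct.ext' fun t j => ?_) c
      simp only [i, μ, LinearMap.comp_apply, LinearMap.smul_apply, LinearMap.id_apply, map_smul,
        LinearMap.lTensor_tmul, ← TensorProduct.tmul_smul]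
      rfl
    rw [hμ, ← map_add, hi] at hz
    rw [hμ, ← map_add, (injective_iff_map_eq_zero _).mp (hinj (s + 1)) _ hz, map_zero]

theorem RingTheory.Sequence.IsWeaklyRegular.smulMap_injective {rs : List R}
    (h : RingTheory.Sequence.IsWeaklyRegular T rs) (s : ℕ) :
    Function.Injective (smulMap T (Ideal.ofList rs) s) := by
  suffices H : PreservesRegularity T (Ideal.ofList rs) ∧
      ∀ s, Function.Injective (smulMap T (Ideal.ofList rs) s) from H.2 s
  clear s
  induction rs using List.reverseRecOn with
  | nil =>
    rw [Ideal.ofList_nil]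
    exact ⟨.bot, smulMap_bot_injective⟩
  | append_singleton rs x ih =>
    obtain ⟨hrs, hx⟩ := (RingTheory.Sequence.isWeaklyRegular_append_iff T rs [x]).mp h
    rw [RingTheory.Sequence.isWeaklyRegular_singleton_iff,
      isSMulRegular_quotient_iff_mem_of_smul_mem] at hx
    obtain ⟨hpres, hinj⟩ := ih hrs
    rw [Ideal.ofList_append, Ideal.ofList_singleton]
    exact ⟨hpres.sup_span_singleton hx, smulMap_sup_span_singleton_injective hpres hx hinj⟩

end RegularPowers

theorem statement_12 {R : Type} [CommRing R] {m : ℕ} (hm : 1 ≤ m) (x : Fin m → R)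
    (hreg : RingTheory.Sequence.IsRegular R (List.ofFn x))
    (J : Ideal R) (hJ : J = Ideal.span (Set.range x))
    (T : Type) [AddCommGroup T] [Module R T]
    (hregT : RingTheory.Sequence.IsRegular T (List.ofFn x)) (s : ℕ) :
    Function.Injective (smulMap T J s) ∧
    LinearMap.range (smulMap T J s) = (J ^ s • ⊤ : Submodule R T) ∧
    (∃ e : (T ⊗[R] ↥(J ^ s)) ≃ₗ[R] ↥(J ^ s • ⊤ : Submodule R T),
      ∀ (t : T) (j : ↥(J ^ s)),
        (e (t ⊗ₜ j) : T) = (j : R) • t) ∧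
    (∃ e₂ : (T ⊗[R] IadicGr J s) ≃ₗ[R]
        (↥(J ^ s • ⊤ : Submodule R T) ⧸
          (Submodule.comap (J ^ s • ⊤ : Submodule R T).subtype
            (J ^ (s + 1) • ⊤ : Submodule R T))),
      ∀ (t : T) (j : ↥(J ^ s)),
        e₂ (t ⊗ₜ Submodule.Quotient.mk j) =
          Submodule.Quotient.mk
            ⟨(j : R) • t, Submodule.smul_mem_smul j.2 Submodule.mem_top⟩) := by
  obtain rfl : J = Ideal.ofList (List.ofFn x) := by
    rw [hJ, Ideal.ofList]
    congr 1
    ext r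
    simp [List.mem_ofFn]
  set J := Ideal.ofList (List.ofFn x)
  have hinj := hregT.toIsWeaklyRegular.smulMap_injective s
  let e : (T ⊗[R] ↥(J ^ s)) ≃ₗ[R] ↥(J ^ s • ⊤ : Submodule R T) :=
    LinearEquiv.ofInjective (smulMap T J s) hinj ≪≫ₗ LinearEquiv.ofEq _ _ (range_smulMap J s)
  have he (z : T ⊗[R] ↥(J ^ s)) : (e z : T) = smulMap T J s z := rfl
  refine ⟨hinj, range_smulMap J s, ⟨e, fun _ _ => rfl⟩, ?_⟩
  let N : Submodule R ↥(J ^ s) := Submodule.comap (J ^ s).subtype (J ^ (s + 1))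
  have hmap : Submodule.map (e : (T ⊗[R] ↥(J ^ s)) →ₗ[R] ↥(J ^ s • ⊤ : Submodule R T))
      (LinearMap.range (TensorProduct.map (LinearMap.id : T →ₗ[R] T) N.subtype)) =
      Submodule.comap (J ^ s • ⊤ : Submodule R T).subtype (J ^ (s + 1) • ⊤) := by
    apply le_antisymm
    · rintro _ ⟨_, ⟨z, rfl⟩, rfl⟩
      induction z with
      | zero => simp
      | tmul t j => exact Submodule.smul_mem_smul (N := (⊤ : Submodule R T)) j.2 Submodule.mem_top
      | add z w hz hw =>
        rw [map_add, map_add]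
        exact add_mem hz hw
    · rintro ⟨t, ht⟩ ht'
      have hle : J ^ (s + 1) ≤ J ^ s := Ideal.pow_le_pow_right s.le_succ
      obtain ⟨z, rfl⟩ : t ∈ LinearMap.range (smulMap T J (s + 1)) := by
        rw [range_smulMap]
        exact ht'
      let f : ↥(J ^ (s + 1)) →ₗ[R] N := (Submodule.inclusion hle).codRestrict N fun j => j.2
      refine ⟨_, ⟨f.lTensor T z, rfl⟩, Subtype.ext ?_⟩
      exact LinearMap.congr_fun (f := smulMap T J s ∘ₗ TensorProduct.map LinearMap.id N.subtype ∘ₗ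
        f.lTensor T) (g := smulMap T J (s + 1)) (TensorProduct.ext' fun _ _ => rfl) z
  exact ⟨TensorProduct.tensorQuotientEquiv T N ≪≫ₗ Submodule.Quotient.equiv _ _ e hmap,
    fun _ _ => rfl⟩

end
end

section
/- Let V = L^m be the free L-module with basis e_1, …, e_m, and for l ≥ 1 and s ≥ 0 define δ : Λ^l_L(V) ⊗_L (J^s/J^{s+1}) → Λ^{l-1}_L(V) ⊗_L (J^{s+1}/J^{s+2}) by δ(e_{i_1}∧⋯∧e_{i_l} ⊗ f̄) = Σ_{j=1}^{l} (−1)^{j+1} e_{i_1}∧⋯∧ê_{i_j}∧⋯∧e_{i_l} ⊗ (x_{i_j} f)‾, where ê_{i_j} means that the factor e_{i_j} is omitted and f̄ denotes the class in J^s/J^{s+1} of f ∈ J^s. Then δ∘δ = 0, and for every N ≥ 1 the complex 0 → Λ^N_L(V) ⊗_L (R/J... J^0/J^1) → Λ^{N-1}_L(V) ⊗_L (J/J^2) → ⋯ → Λ^1_L(V) ⊗_L (J^{N-1}/J^N) → Λ^0_L(V) ⊗_L (J^N/J^{N+1}) → 0 (with terms Λ^{N-s}_L(V) ⊗_L (J^s/J^{s+1})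 for 0 ≤ s ≤ N and differentials δ) is exact at every term; that is, the leftmost map is injective, the rightmost map is surjective, and kernels equal images at all intermediate terms. -/
/-!
Statement 13: the Koszul-type complexes
`0 → Λ^N_L(V) ⊗_L (J^0/J^1) → Λ^{N-1}_L(V) ⊗_L (J/J^2) → ⋯ → Λ^0_L(V) ⊗_L (J^N/J^{N+1}) → 0`
(`V = L^m`, differentials `δ(e_{i₁}∧⋯∧e_{i_l} ⊗ f̄) = Σ_j (-1)^{j+1}
e_{i₁}∧⋯∧ê_{i_j}∧⋯∧e_{i_l} ⊗ (x_{i_j} f)‾`) satisfy `δ∘δ = 0` and are exact.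
-/

open TensorProduct

set_option synthInstance.maxHeartbeats 1000000
set_option maxHeartbeats 1000000

noncomputable section

lemma IadicGr.isTorsionBySet {R : Type} [CommRing R] (J : Ideal R) (s : ℕ) :
    Module.IsTorsionBySet R (IadicGr J s) (J : Set R) := by
  intro z a
  obtain ⟨y, rfl⟩ := Submodule.Quotient.mk_surjective _ z
  rw [← Submodule.Quotient.mk_smul, Submodule.Quotient.mk_eq_zero]
  simp only [Submodule.mem_comap, Submodule.coe_subtype, SetLike.val_smul, smul_eq_mul]
  have : (a : R) * (y : R) ∈ J * J ^ s := Ideal.mul_mem_mul a.2 y.2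
  rwa [← pow_succ'] at this

/-- The `L = R/J`-module structure on `J^s/J^{s+1}`. -/
noncomputable instance {R : Type} [CommRing R] (J : Ideal R) (s : ℕ) :
    Module (R ⧸ J) (IadicGr J s) :=
  (IadicGr.isTorsionBySet J s).module

lemma mul_mem_pow_succ {R : Type} [CommRing R] (J : Ideal R) {s : ℕ} {a : R}
    (ha : a ∈ J) (f : ↥(J ^ s)) : a * (f : R) ∈ J ^ (s + 1) := by
  have : a * (f : R) ∈ J * J ^ s := Ideal.mul_mem_mul ha f.2
  rwa [← pow_succ'] at this

/-- The elementary wedge `v₁ ∧ ⋯ ∧ v_l` in the `l`-th exterior power. -/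
def wedge {L : Type} [CommRing L] {V : Type} [AddCommGroup V] [Module L V]
    (l : ℕ) (v : Fin l → V) : ↥(⋀[L]^l V) :=
  ⟨ExteriorAlgebra.ιMulti L l v, ExteriorAlgebra.ιMulti_range L l (Set.mem_range_self v)⟩

open MvPolynomial in
lemma MvPolynomial.IsHomogeneous.eval_mem_span_range_pow_succ {σ R : Type*} [CommRing R] {x : σ → R}
    {s : ℕ} {P : MvPolynomial σ R} (hP : P.IsHomogeneous s)
    (hPJ : P ∈ (Ideal.span (Set.range x)).map (C : R →+* MvPolynomial σ R)) :
    eval x P ∈ Ideal.span (Set.range x) ^ (s + 1) := by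
  rw [mem_map_C_iff] at hPJ
  rw [P.as_sum, map_sum]
  refine sum_mem fun d hd => ?_
  rw [← mul_one (coeff d P), ← C_mul_monomial, map_mul, eval_C, pow_succ']
  refine Ideal.mul_mem_mul (hPJ d) ?_
  rw [Ideal.mem_span_pow_iff_exists_isHomogeneous]
  refine ⟨_, isHomogeneous_monomial 1 ?_, rfl⟩
  rw [← hP (mem_support_iff.1 hd), Finsupp.degree_eq_weight_one]
  rfl

open MvPolynomial in
lemma Ideal.exists_isHomogeneous_mem_map_C {σ R : Type*} [CommRing R] {x : σ → R} {s : ℕ} {r : R}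
    (hr : r ∈ Ideal.span (Set.range x) ^ (s + 1)) :
    ∃ P : MvPolynomial σ R, P.IsHomogeneous s ∧
      P ∈ (Ideal.span (Set.range x)).map (C : R →+* MvPolynomial σ R) ∧ eval x P = r := by
  rw [pow_succ'] at hr
  induction hr using Submodule.mul_induction_on' with
  | mem_mul_mem a ha b hb =>
    obtain ⟨Q, hQ, rfl⟩ := (Ideal.mem_span_pow_iff_exists_isHomogeneous x b).1 hb
    exact ⟨C a * Q, hQ.C_mul a, Ideal.mul_mem_right _ _ (Ideal.mem_map_of_mem _ ha), by simp⟩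
  | add a _ b _ iha ihb =>
    obtain ⟨P, hP, hPJ, rfl⟩ := iha
    obtain ⟨Q, hQ, hQJ, rfl⟩ := ihb
    exact ⟨P + Q, hP.add hQ, add_mem hPJ hQJ, by simp⟩

open MvPolynomial in
lemma MvPolynomial.IsHomogeneous.exists_eq_rename_castSucc_add {R : Type*} [CommRing R] {n s : ℕ}
    {F : MvPolynomial (Fin (n + 1)) R} (hF : F.IsHomogeneous (s + 1)) :
    ∃ (G : MvPolynomial (Fin n) R) (H : MvPolynomial (Fin (n + 1)) R),
      G.IsHomogeneous (s + 1) ∧ H.IsHomogeneous s ∧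
        F = rename Fin.castSucc G + X (Fin.last n) * H := by
  classical
  set e : Fin (n + 1) →₀ ℕ := Finsupp.single (Fin.last n) 1
  have hvars : ((F.modMonomial e).vars : Set (Fin (n + 1))) ⊆ Set.range Fin.castSucc := by
    intro i hi
    obtain ⟨d, hd, hid⟩ := (mem_vars_iff_mem_support i).1 hi
    suffices h : i ≠ Fin.last n from ⟨i.castPred h, Fin.castSucc_castPred i h⟩
    rintro rfl
    refine mem_support_iff.1 hd (coeff_modMonomial_of_le _ ?_)
    exact Finsupp.single_le_iff.2 (Nat.one_le_iff_ne_zero.2 (Finsupp.mem_support_iff.1 hid))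
  obtain ⟨G, hG⟩ := exists_rename_eq_of_vars_subset_range _ _ (Fin.castSucc_injective n) hvars
  refine ⟨G, F.divMonomial e, ?_, ?_, ?_⟩
  · rw [← IsHomogeneous.rename_isHomogeneous_iff (Fin.castSucc_injective n), hG]
    intro d hd
    by_cases h : e ≤ d
    · exact absurd (coeff_modMonomial_of_le _ h) hd
    · rw [coeff_modMonomial_of_not_le _ h] at hd
      exact hF hd
  · intro d hd
    rw [coeff_divMonomial] at hd
    have := hF hd
    simp only [map_add, e, Finsupp.weight_single] at this
    simp at this
    omega
  · rw [hG]
    exact (modMonomial_add_divMonomial_single F (Fin.last n)).symm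

/-- `x` is a weakly regular sequence, phrased through the ideals generated by initial segments. -/
def IsRegularSeq {R : Type*} [CommRing R] {n : ℕ} (x : Fin n → R) : Prop :=
  ∀ (k : Fin n) (r : R), x k * r ∈ Ideal.span (x '' Set.Iio k) → r ∈ Ideal.span (x '' Set.Iio k)

lemma isRegularSeq_of_isWeaklyRegular {R : Type*} [CommRing R] {n : ℕ} {x : Fin n → R}
    (h : RingTheory.Sequence.IsWeaklyRegular R (List.ofFn x)) : IsRegularSeq x := by
  intro k r hr
  have hk : (k : ℕ) < (List.ofFn x).length := by simp
  have hI : Ideal.ofList ((List.ofFn x).take k) = Ideal.span (x '' Set.Iio k) := by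
    rw [Ideal.ofList]
    congr 1
    ext y
    simp only [Set.mem_ofPred_eq, List.mem_take_iff_getElem, Set.mem_image, Set.mem_Iio]
    constructor
    · rintro ⟨i, hi, rfl⟩
      exact ⟨⟨i, by simp at hi; omega⟩, Fin.lt_def.2 (by simp at hi; simp [hi]), by simp⟩
    · rintro ⟨i, hi, rfl⟩
      exact ⟨i, by simpa using hi, by simp⟩
  have := h.regular_mod_prev k hk
  rw [hI, isSMulRegular_quotient_iff_mem_of_smul_mem] at this
  simpa using this r (by simpa using hr)

open MvPolynomial in
/-- A regular sequence is quasi-regular. -/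
theorem IsRegularSeq.mem_map_C_of_eval_mem {R : Type*} [CommRing R] {n : ℕ} {x : Fin n → R}
    (hx : IsRegularSeq x) {s : ℕ} {F : MvPolynomial (Fin n) R} (hF : F.IsHomogeneous s)
    (hFx : eval x F ∈ Ideal.span (Set.range x) ^ (s + 1)) :
    F ∈ (Ideal.span (Set.range x)).map (C : R →+* MvPolynomial (Fin n) R) := by
  have hzero : ∀ {n : ℕ} {x : Fin n → R} {F : MvPolynomial (Fin n) R}, F.IsHomogeneous 0 →
      eval x F ∈ Ideal.span (Set.range x) ^ (0 + 1) →
      F ∈ (Ideal.span (Set.range x)).map (C : R →+* MvPolynomial (Fin n) R) := by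
    intro n x F hF hFx
    rw [totalDegree_eq_zero_iff_eq_C.1 ((totalDegree_zero_iff_isHomogeneous _).2 hF)] at hFx ⊢
    exact Ideal.mem_map_of_mem _ (by simpa using hFx)
  induction n generalizing s with
  | zero =>
    cases s with
    | zero => exact hzero hF hFx
    | succ s =>
      convert Ideal.zero_mem _
      ext d
      by_contra h
      have := hF h
      simp [Subsingleton.elim d 0] at this
  | succ n ihn =>
    set x' : Fin n → R := x ∘ Fin.castSucc with hx'
    set y := x (Fin.last n)
    set J := Ideal.span (Set.range x)
    set J' := Ideal.span (Set.range x')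
    have hx'reg : IsRegularSeq x' := by
      intro k r hr
      have := hx k.castSucc r
      have he : x '' Set.Iio k.castSucc = x' '' Set.Iio k := by
        rw [hx', Set.image_comp, Fin.image_castSucc_Iio]
      rw [he] at this
      exact this hr
    have hyreg : ∀ r, y * r ∈ J' → r ∈ J' := by
      have he : x '' Set.Iio (Fin.last n) = Set.range x' := by
        rw [hx', Set.range_comp, Fin.range_castSucc]
        rfl
      have := hx (Fin.last n)
      rwa [he] at this
    have hJ : J' ≤ J := Ideal.span_mono (Set.range_comp_subset_range _ _)
    have hyJ : y ∈ J := Ideal.subset_span ⟨_, rfl⟩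
    have hypow : ∀ t r, y * r ∈ J' ^ t → r ∈ J' ^ t := by
      intro t
      induction t with
      | zero => simp
      | succ t iht =>
        intro r hr
        obtain ⟨P, hP, rfl⟩ := (Ideal.mem_span_pow_iff_exists_isHomogeneous x' r).1
          (iht r (Ideal.pow_le_pow_right (Nat.le_succ t) hr))
        refine hP.eval_mem_span_range_pow_succ ?_
        have := ihn hx'reg (hP.C_mul y) (by simpa using hr)
        rw [mem_map_C_iff] at this ⊢
        exact fun d => hyreg _ (by simpa using this d)
    induction s generalizing F with
    | zero => exact hzero hF hFx
    | succ s ihs =>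
      obtain ⟨P, hP, hPJ, hPF⟩ := Ideal.exists_isHomogeneous_mem_map_C hFx
      suffices h : F - P ∈ J.map (C : R →+* MvPolynomial (Fin (n + 1)) R) by
        simpa using add_mem h hPJ
      obtain ⟨G, H, hG, hH, hGH⟩ := (hF.sub hP).exists_eq_rename_castSucc_add
      have hev : eval x' G + y * eval x H = 0 := by
        have := congrArg (eval x) hGH
        rw [map_sub, hPF, sub_self, map_add, eval_rename, map_mul, eval_X] at this
        exact this.symm
      have hHJ' : eval x H ∈ J' ^ (s + 1) := by
        refine hypow _ _ ?_
        rw [← neg_eq_of_add_eq_zero_right hev]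
        exact neg_mem ((Ideal.mem_span_pow_iff_exists_isHomogeneous x' _).2 ⟨G, hG, rfl⟩)
      have hHJ := ihs hH (Ideal.pow_right_mono hJ _ hHJ')
      obtain ⟨H', hH', hHH'⟩ := (Ideal.mem_span_pow_iff_exists_isHomogeneous x' _).1 hHJ'
      have hGJ := ihn hx'reg (hG.add (hH'.C_mul y)) (by simp [hHH', hev])
      have hren : ∀ {Q : MvPolynomial (Fin n) R}, Q ∈ J'.map C →
          rename Fin.castSucc Q ∈ J.map (C : R →+* MvPolynomial (Fin (n + 1)) R) := by
        intro Q hQ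
        have := Ideal.mem_map_of_mem (rename Fin.castSucc :
          MvPolynomial (Fin n) R →ₐ[R] MvPolynomial (Fin (n + 1)) R).toRingHom hQ
        rw [Ideal.map_map, show (rename Fin.castSucc : MvPolynomial (Fin n) R →ₐ[R]
          MvPolynomial (Fin (n + 1)) R).toRingHom.comp C = C by ext; simp] at this
        exact Ideal.map_mono hJ this
      rw [hGH]
      refine add_mem ?_ (Ideal.mul_mem_left _ _ hHJ)
      have h1 := hren hGJ
      rw [map_add, map_mul, rename_C] at h1
      exact (add_mem_cancel_right (Ideal.mul_mem_right _ _ (Ideal.mem_map_of_mem _ hyJ))).1 h1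

namespace ExteriorAlgebra

variable {L : Type*} [CommRing L]

section Contraction

variable {V : Type*} [AddCommGroup V] [Module L V]

/-- Left contraction of the exterior algebra by a linear form. -/
noncomputable def contract (d : Module.Dual L V) : ExteriorAlgebra L V →ₗ[L] ExteriorAlgebra L V :=
  CliffordAlgebra.contractLeft d

lemma contract_ι_mul (d : Module.Dual L V) (v : V) (ω : ExteriorAlgebra L V) :
    contract d (ι L v * ω) = d v • ω - ι L v * contract d ω :=
  CliffordAlgebra.contractLeft_ι_mul d v ω

lemma contract_algebraMap (d : Module.Dual L V) (r : L) :
    contract d (algebraMap L (ExteriorAlgebra L V) r) = 0 :=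
  CliffordAlgebra.contractLeft_algebraMap _ d r

lemma contract_one (d : Module.Dual L V) : contract d (1 : ExteriorAlgebra L V) = 0 :=
  CliffordAlgebra.contractLeft_one _ d

lemma contract_contract (d : Module.Dual L V) (ω : ExteriorAlgebra L V) :
    contract d (contract d ω) = 0 :=
  CliffordAlgebra.contractLeft_contractLeft d ω

lemma contract_comm (d d' : Module.Dual L V) (ω : ExteriorAlgebra L V) :
    contract d (contract d' ω) = -contract d' (contract d ω) :=
  CliffordAlgebra.contractLeft_comm d d' ω

lemma contract_zero : contract (0 : Module.Dual L V) = 0 :=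
  map_zero _

@[elab_as_elim]
lemma left_induction {P : ExteriorAlgebra L V → Prop} (ω : ExteriorAlgebra L V)
    (algebraMap : ∀ r : L, P (algebraMap L _ r)) (add : ∀ a b, P a → P b → P (a + b))
    (ι_mul : ∀ ω v, P ω → P (ι L v * ω)) : P ω :=
  CliffordAlgebra.left_induction (Q := (0 : QuadraticForm L V)) algebraMap add ι_mul ω

lemma contract_map {W : Type*} [AddCommGroup W] [Module L W]
    (f : V →ₗ[L] W) (d : Module.Dual L W) (ω : ExteriorAlgebra L V) :
    contract d (map f ω) =
      map f (contract (d ∘ₗ f) ω) := by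
  induction ω using left_induction with
  | algebraMap r =>
    rw [contract_algebraMap, map_zero, AlgHom.commutes, contract_algebraMap]
  | add a b ha hb => simp only [map_add, ha, hb]
  | ι_mul ω v h =>
    rw [map_mul, map_apply_ι, contract_ι_mul, contract_ι_mul, h, map_sub, map_smul,
      map_mul, map_apply_ι]
    rfl

lemma contract_ιMulti (d : Module.Dual L V) (l : ℕ)
    (v : Fin (l + 1) → V) :
    contract d (ιMulti L (l + 1) v) =
      ∑ k : Fin (l + 1), (-1 : ℤ) ^ (k : ℕ) • d (v k) • ιMulti L l (fun t => v (k.succAbove t)) := by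
  induction l with
  | zero =>
    rw [ιMulti_succ_apply, contract_ι_mul, ιMulti_zero_apply, contract_one]
    simp
  | succ l ih =>
    rw [ιMulti_succ_apply, contract_ι_mul, ih, Fin.sum_univ_succ (n := l + 1), Finset.mul_sum,
      sub_eq_add_neg, ← Finset.sum_neg_distrib]
    congr 1
    · simp [Matrix.vecTail, Function.comp_def]
    · refine Finset.sum_congr rfl fun k _ => ?_
      rw [ιMulti_succ_apply, mul_smul_comm, mul_smul_comm, Fin.val_succ, pow_succ, mul_neg_one,
        neg_smul]
      simp [Matrix.vecTail, Function.comp_def]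

end Contraction

variable {m : ℕ}

/-- The projection of `L^m` killing the first `i` coordinates. -/
noncomputable def tailProj (L : Type*) [CommRing L] (m i : ℕ) : (Fin m → L) →ₗ[L] (Fin m → L) :=
  LinearMap.pi fun j => if (j : ℕ) < i then 0 else LinearMap.proj j

lemma tailProj_zero : tailProj L m 0 = LinearMap.id := by
  ext; simp [tailProj]

lemma tailProj_self : tailProj L m m = 0 := by
  ext; simp [tailProj]

lemma tailProj_eq_add (j : Fin m) (v : Fin m → L) :
    tailProj L m j v = v j • Pi.single j 1 + tailProj L m (j + 1) v := by
  ext k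
  rcases lt_trichotomy (k : ℕ) j with h | h | h
  · have : k ≠ j := fun e => by simp [e] at h
    replace h : k < j := h
    simp [tailProj, h, h.le, this]
  · obtain rfl := Fin.ext h
    simp [tailProj]
  · have : k ≠ j := fun e => by simp [e] at h
    replace h : j < k := h
    simp [tailProj, this, h.not_gt, h.not_ge]

lemma contract_map_tailProj_of_lt {i : ℕ} {j : Fin m} (h : (j : ℕ) < i)
    (ω : ExteriorAlgebra L (Fin m → L)) :
    contract (LinearMap.proj j) (map (tailProj L m i) ω) = 0 := by
  rw [contract_map, show LinearMap.proj j ∘ₗ tailProj L m i = 0 by ext; simp [tailProj, h],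
    contract_zero, LinearMap.zero_apply, map_zero]

lemma contract_map_tailProj_of_le {i : ℕ} {j : Fin m} (h : i ≤ j)
    (ω : ExteriorAlgebra L (Fin m → L)) :
    contract (LinearMap.proj j) (map (tailProj L m i) ω) =
      map (tailProj L m i) (contract (LinearMap.proj j) ω) := by
  rw [contract_map,
    show LinearMap.proj j ∘ₗ tailProj L m i = LinearMap.proj j by ext; simp [tailProj, h.not_gt]]

lemma ι_single_mul_contract_map_tailProj (j : Fin m) (ω : ExteriorAlgebra L (Fin m → L)) :
    ι L (Pi.single j 1) *
        contract (LinearMap.proj j) (map (tailProj L m j) ω) =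
      map (tailProj L m j) ω - map (tailProj L m (j + 1)) ω := by
  induction ω using left_induction with
  | algebraMap r =>
    rw [AlgHom.commutes, AlgHom.commutes, contract_algebraMap, mul_zero, sub_self]
  | add a b ha hb => simp only [map_add, mul_add, ha, hb]; abel
  | ι_mul ω v h =>
    set e : ExteriorAlgebra L (Fin m → L) := ι L (Pi.single j 1)
    set A := map (tailProj L m j) ω
    set B := map (tailProj L m (j + 1)) ω
    have hp : (LinearMap.proj j : (Fin m → L) →ₗ[L] L) (tailProj L m j v) = v j := by
      simp [tailProj]
    have hanti : e * ι L (tailProj L m j v) = - (ι L (tailProj L m j v) * e) :=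
      eq_neg_of_add_eq_zero_left (ι_add_mul_swap _ _)
    have hee : e * (A - B) = 0 := by
      rw [← h, ← mul_assoc, ι_sq_zero, zero_mul]
    have hsplit : ι L (tailProj L m j v) = v j • e + ι L (tailProj L m (j + 1) v) := by
      rw [tailProj_eq_add, map_add, map_smul]
    have hm : ∀ i, map (tailProj L m i) (ι L v * ω) =
        ι L (tailProj L m i v) * map (tailProj L m i) ω := fun i => by rw [map_mul, map_apply_ι]
    rw [hm, hm, contract_ι_mul, hp, mul_sub,
      ← mul_assoc, hanti, neg_mul, mul_assoc, h, sub_neg_eq_add, mul_smul_comm]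
    have h2 : ι L (tailProj L m (j + 1) v) = ι L (tailProj L m j v) - v j • e := by
      rw [hsplit]; abel
    rw [h2]
    have h3 : e * A = e * B := by rwa [mul_sub, sub_eq_zero] at hee
    rw [sub_mul, smul_mul_assoc, ← h3, mul_sub]
    abel

end ExteriorAlgebra

namespace Koszul

open MvPolynomial ExteriorAlgebra

variable {L : Type*} [CommRing L] {m : ℕ}

/-- `i` is the first index with a nonzero exponent in the monomial `a`. -/
def IsFirst (i : Fin m) (a : Fin m →₀ ℕ) : Prop := a i ≠ 0 ∧ ∀ k < i, a k = 0

lemma IsFirst.unique {i j : Fin m} {a : Fin m →₀ ℕ} (hi : IsFirst i a) (hj : IsFirst j a) :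
    i = j :=
  le_antisymm (not_lt.1 fun h => hj.1 (hi.2 _ h)) (not_lt.1 fun h => hi.1 (hj.2 _ h))

lemma exists_isFirst {a : Fin m →₀ ℕ} (ha : a ≠ 0) : ∃ i, IsFirst i a := by
  have hne : a.support.Nonempty := Finsupp.support_nonempty_iff.2 ha
  refine ⟨a.support.min' hne, Finsupp.mem_support_iff.1 (Finset.min'_mem _ hne), fun k hk => ?_⟩
  by_contra h
  exact hk.not_ge (Finset.min'_le _ _ (Finsupp.mem_support_iff.2 h))

lemma IsFirst.add_single_of_lt {i j : Fin m} {a : Fin m →₀ ℕ} (hi : IsFirst i a) (hij : i < j) :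
    IsFirst i (a + Finsupp.single j 1) := by
  refine ⟨by simp [hi.1], fun k hk => ?_⟩
  simp [hi.2 k hk, (hk.trans hij).ne]

lemma isFirst_add_single {j : Fin m} {a : Fin m →₀ ℕ} (h : ∀ k < j, a k = 0) :
    IsFirst j (a + Finsupp.single j 1) := by
  refine ⟨by simp, fun k hk => ?_⟩
  simp [h k hk, hk.ne]

open Classical in
/-- Division by the variable `X i`, on the monomials whose first variable is `X i`; the other
monomials are sent to `0`. -/
noncomputable def divFirst (L : Type*) [CommRing L] (i : Fin m) :
    MvPolynomial (Fin m) L →ₗ[L] MvPolynomial (Fin m) L :=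
  (basisMonomials (Fin m) L).constr L fun a =>
    if IsFirst i a then monomial (a - Finsupp.single i 1) 1 else 0

lemma divFirst_of_isFirst {i : Fin m} {a : Fin m →₀ ℕ} (h : IsFirst i a) :
    divFirst L i (monomial a 1) = monomial (a - Finsupp.single i 1) 1 := by
  have := (basisMonomials (Fin m) L).constr_basis L (fun a => open Classical in
    if IsFirst i a then (monomial (a - Finsupp.single i 1) 1 : MvPolynomial (Fin m) L) else 0) a
  rw [coe_basisMonomials, if_pos h] at this
  exact this

lemma divFirst_of_not_isFirst {i : Fin m} {a : Fin m →₀ ℕ} (h : ¬ IsFirst i a) :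
    divFirst L i (monomial a 1) = 0 := by
  have := (basisMonomials (Fin m) L).constr_basis L (fun a => open Classical in
    if IsFirst i a then (monomial (a - Finsupp.single i 1) 1 : MvPolynomial (Fin m) L) else 0) a
  rw [coe_basisMonomials, if_neg h] at this
  exact this

lemma divFirst_mem {s : ℕ} (i : Fin m) {F : MvPolynomial (Fin m) L}
    (hF : F ∈ homogeneousSubmodule (Fin m) L (s + 1)) :
    divFirst L i F ∈ homogeneousSubmodule (Fin m) L s := by
  rw [F.as_sum, map_sum]
  refine sum_mem fun a ha => ?_
  rw [← mul_one (coeff a F), ← smul_eq_mul, ← smul_monomial, map_smul]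
  refine Submodule.smul_mem _ _ ?_
  by_cases h : IsFirst i a
  · rw [divFirst_of_isFirst h]
    refine isHomogeneous_monomial 1 ?_
    have h1 : a.degree = s + 1 := by
      rw [Finsupp.degree_eq_weight_one]
      exact hF (mem_support_iff.1 ha)
    have h2 : a - Finsupp.single i 1 + Finsupp.single i 1 = a :=
      tsub_add_cancel_of_le (Finsupp.single_le_iff.2 (Nat.one_le_iff_ne_zero.2 h.1))
    have h3 := congrArg Finsupp.degree h2
    rw [map_add, Finsupp.degree_single] at h3
    omega
  · rw [divFirst_of_not_isFirst h]
    exact zero_mem _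

/-- The Koszul differential on `Λ(L^m) ⊗ L[X₁, …, X_m]`. -/
noncomputable def differential (L : Type*) [CommRing L] (m : ℕ) :
    ExteriorAlgebra L (Fin m → L) ⊗[L] MvPolynomial (Fin m) L →ₗ[L]
      ExteriorAlgebra L (Fin m → L) ⊗[L] MvPolynomial (Fin m) L :=
  ∑ j, TensorProduct.map (contract (LinearMap.proj j)) (LinearMap.mulLeft L (X j))

/-- The contracting homotopy of the Koszul complex. -/
noncomputable def homotopy (L : Type*) [CommRing L] (m : ℕ) :
    ExteriorAlgebra L (Fin m → L) ⊗[L] MvPolynomial (Fin m) L →ₗ[L]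
      ExteriorAlgebra L (Fin m → L) ⊗[L] MvPolynomial (Fin m) L :=
  ∑ i : Fin m, TensorProduct.map
    (LinearMap.mulLeft L (ι L (Pi.single i 1)) ∘ₗ (ExteriorAlgebra.map (tailProj L m i)).toLinearMap)
    (divFirst L i)

lemma differential_tmul (ω : ExteriorAlgebra L (Fin m → L)) (F : MvPolynomial (Fin m) L) :
    differential L m (ω ⊗ₜ F) = ∑ j, contract (LinearMap.proj j) ω ⊗ₜ (X j * F) := by
  simp [differential, LinearMap.sum_apply]

lemma homotopy_tmul (ω : ExteriorAlgebra L (Fin m → L)) (F : MvPolynomial (Fin m) L) :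
    homotopy L m (ω ⊗ₜ F) = ∑ i : Fin m,
      (ι L (Pi.single i 1) * ExteriorAlgebra.map (tailProj L m i) ω) ⊗ₜ divFirst L i F := by
  simp [homotopy, LinearMap.sum_apply]

lemma homotopy_tmul_monomial {i : Fin m} {a : Fin m →₀ ℕ} (h : IsFirst i a)
    (ω : ExteriorAlgebra L (Fin m → L)) :
    homotopy L m (ω ⊗ₜ monomial a 1) =
      (ι L (Pi.single i 1) * ExteriorAlgebra.map (tailProj L m i) ω) ⊗ₜ
        monomial (a - Finsupp.single i 1) 1 := by
  rw [homotopy_tmul, Finset.sum_eq_single i, divFirst_of_isFirst h]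
  · intro k _ hk
    rw [divFirst_of_not_isFirst fun h' => hk (h'.unique h), tmul_zero]
  · simp

lemma X_mul_monomial_one (j : Fin m) (a : Fin m →₀ ℕ) :
    (X j * monomial a 1 : MvPolynomial (Fin m) L) = monomial (a + Finsupp.single j 1) 1 := by
  rw [X, monomial_mul, one_mul, add_comm]

lemma homotopy_contract_tmul {j : Fin m} {a : Fin m →₀ ℕ} (h : ∀ k < j, a k = 0)
    (ω : ExteriorAlgebra L (Fin m → L)) :
    homotopy L m (contract (LinearMap.proj j) ω ⊗ₜ (X j * monomial a 1)) =
      (ExteriorAlgebra.map (tailProj L m j) ω - ExteriorAlgebra.map (tailProj L m (j + 1)) ω) ⊗ₜ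
        monomial a 1 := by
  rw [X_mul_monomial_one, homotopy_tmul_monomial (isFirst_add_single h), add_tsub_cancel_right,
    ← contract_map_tailProj_of_le le_rfl, ι_single_mul_contract_map_tailProj]

lemma sum_tailProj_sub (ω : ExteriorAlgebra L (Fin m → L)) {i : ℕ} (hi : i ≤ m) :
    ∑ j : Fin m, (if (j : ℕ) < i then ExteriorAlgebra.map (tailProj L m j) ω -
      ExteriorAlgebra.map (tailProj L m (j + 1)) ω else 0) =
        ω - ExteriorAlgebra.map (tailProj L m i) ω := by
  rw [Fin.sum_univ_eq_sum_range (fun j => if j < i then ExteriorAlgebra.map (tailProj L m j) ω -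
      ExteriorAlgebra.map (tailProj L m (j + 1)) ω else 0), ← Finset.sum_filter,
    show (Finset.range m).filter (· < i) = Finset.range i by ext; simp; omega,
    Finset.sum_range_sub', tailProj_zero, ExteriorAlgebra.map_id]
  rfl

lemma homotopy_differential_one (ω : ExteriorAlgebra L (Fin m → L)) :
    homotopy L m (differential L m (ω ⊗ₜ 1)) =
      (ω - ExteriorAlgebra.map (tailProj L m m) ω) ⊗ₜ 1 := by
  rw [differential_tmul, map_sum, ← sum_tailProj_sub ω le_rfl, sum_tmul]
  refine Finset.sum_congr rfl fun j _ => ?_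
  have := homotopy_contract_tmul (a := 0) (j := j) (fun _ _ => rfl) ω
  rwa [if_pos j.2]

lemma homotopy_differential_add_monomial (ω : ExteriorAlgebra L (Fin m → L)) {a : Fin m →₀ ℕ}
    (ha : a ≠ 0) :
    homotopy L m (differential L m (ω ⊗ₜ monomial a 1)) +
      differential L m (homotopy L m (ω ⊗ₜ monomial a 1)) = ω ⊗ₜ monomial a 1 := by
  obtain ⟨i, hi⟩ := exists_isFirst ha
  have hai : a - Finsupp.single i 1 + Finsupp.single i 1 = a :=
    tsub_add_cancel_of_le (Finsupp.single_le_iff.2 (Nat.one_le_iff_ne_zero.2 hi.1))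
  rw [homotopy_tmul_monomial hi, differential_tmul, differential_tmul, map_sum,
    ← Finset.sum_add_distrib]
  have key : ∀ j : Fin m,
      homotopy L m (contract (LinearMap.proj j) ω ⊗ₜ (X j * monomial a 1)) +
        contract (LinearMap.proj j)
          (ι L (Pi.single i 1) * ExteriorAlgebra.map (tailProj L m i) ω) ⊗ₜ
            (X j * monomial (a - Finsupp.single i 1) 1) =
      (if (j : ℕ) < i then ExteriorAlgebra.map (tailProj L m j) ω -
        ExteriorAlgebra.map (tailProj L m (j + 1)) ω else 0) ⊗ₜ monomial a 1 +
      (if j = i then ExteriorAlgebra.map (tailProj L m i) ω else 0) ⊗ₜ monomial a 1 := by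
    intro j
    rw [contract_ι_mul]
    rcases lt_trichotomy j i with h | rfl | h
    · rw [homotopy_contract_tmul fun k hk => hi.2 k (hk.trans h),
        contract_map_tailProj_of_lt (Fin.lt_def.1 h), if_pos (Fin.lt_def.1 h), if_neg h.ne]
      simp [h.ne]
    · rw [homotopy_contract_tmul hi.2, if_neg (lt_irrefl _), if_pos rfl, X_mul_monomial_one, hai,
        ι_single_mul_contract_map_tailProj, ← add_tmul, zero_tmul, zero_add]
      simp
    · rw [X_mul_monomial_one, homotopy_tmul_monomial (hi.add_single_of_lt h), X_mul_monomial_one,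
        contract_map_tailProj_of_le (Fin.le_def.1 h.le), if_neg (Fin.lt_def.1 h).not_gt,
        if_neg h.ne', tsub_add_eq_add_tsub (Finsupp.single_le_iff.2 (Nat.one_le_iff_ne_zero.2 hi.1))]
      simp [h.ne', ← add_tmul]
  rw [Finset.sum_congr rfl fun j _ => key j, Finset.sum_add_distrib, ← sum_tmul, ← sum_tmul,
    sum_tailProj_sub ω i.2.le, Finset.sum_ite_eq' Finset.univ i, if_pos (Finset.mem_univ i),
    ← add_tmul, sub_add_cancel]

lemma homotopy_differential_add {s : ℕ} (ω : ExteriorAlgebra L (Fin m → L))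
    {F : MvPolynomial (Fin m) L} (hF : F ∈ homogeneousSubmodule (Fin m) L (s + 1)) :
    homotopy L m (differential L m (ω ⊗ₜ F)) + differential L m (homotopy L m (ω ⊗ₜ F)) =
      ω ⊗ₜ F := by
  rw [F.as_sum]
  simp only [tmul_sum, map_sum, ← Finset.sum_add_distrib]
  refine Finset.sum_congr rfl fun a ha => ?_
  rw [← mul_one (coeff a F), ← smul_eq_mul, ← smul_monomial]
  simp only [tmul_smul, map_smul, ← smul_add]
  rw [homotopy_differential_add_monomial ω]
  rintro rfl
  have := hF (mem_support_iff.1 ha)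
  simp at this

lemma differential_differential (z : ExteriorAlgebra L (Fin m → L) ⊗[L] MvPolynomial (Fin m) L) :
    differential L m (differential L m z) = 0 := by
  induction z with
  | zero => simp
  | add a b ha hb => simp only [map_add, ha, hb, add_zero]
  | tmul ω F =>
    simp only [differential_tmul, map_sum]
    rw [← Finset.sum_product']
    refine Finset.sum_involution (fun p _ => p.swap) (fun p _ => ?_) (fun p _ hp hswap => hp ?_)
      (fun _ _ => Finset.mem_univ _) (fun p _ => Prod.swap_swap p)
    · rw [Prod.fst_swap, Prod.snd_swap, contract_comm, mul_left_comm, neg_tmul, neg_add_cancel]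
    · have : p.2 = p.1 := congrArg Prod.fst hswap
      rw [this, contract_contract, zero_tmul]

lemma map_tailProj_self (l : ℕ) {ω : ExteriorAlgebra L (Fin m → L)}
    (hω : ω ∈ ⋀[L]^(l + 1) (Fin m → L)) : ExteriorAlgebra.map (tailProj L m m) ω = 0 := by
  rw [← ιMulti_span_fixedDegree] at hω
  induction hω using Submodule.span_induction with
  | mem x hx =>
    obtain ⟨v, rfl⟩ := hx
    rw [map_apply_ιMulti, tailProj_self, ιMulti_succ_apply]
    simp
  | zero => simp
  | add a b _ _ ha hb => rw [map_add, ha, hb, add_zero]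
  | smul c a _ ha => rw [map_smul, ha, smul_zero]


section Strand

lemma contract_mem (d : Module.Dual L (Fin m → L)) (l : ℕ) :
    ∀ ω ∈ ⋀[L]^(l + 1) (Fin m → L), contract d ω ∈ ⋀[L]^l (Fin m → L) := by
  intro ω hω
  rw [← ιMulti_span_fixedDegree] at hω
  induction hω using Submodule.span_induction with
  | mem x hx =>
    obtain ⟨v, rfl⟩ := hx
    rw [contract_ιMulti]
    exact sum_mem fun k _ => zsmul_mem (Submodule.smul_mem _ _
      (ιMulti_range L l (Set.mem_range_self _))) _
  | zero => rw [map_zero]; exact zero_mem _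
  | add a b _ _ ha hb => rw [map_add]; exact add_mem ha hb
  | smul c a _ ha => rw [map_smul]; exact Submodule.smul_mem _ _ ha

lemma contract_eq_zero (d : Module.Dual L (Fin m → L)) {ω : ExteriorAlgebra L (Fin m → L)}
    (hω : ω ∈ ⋀[L]^0 (Fin m → L)) : contract d ω = 0 := by
  rw [← ιMulti_span_fixedDegree] at hω
  induction hω using Submodule.span_induction with
  | mem x hx =>
    obtain ⟨v, rfl⟩ := hx
    rw [ιMulti_zero_apply, contract_one]
  | zero => rw [map_zero]
  | add a b _ _ ha hb => rw [map_add, ha, hb, add_zero]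
  | smul c a _ ha => rw [map_smul, ha, smul_zero]

lemma ι_mul_map_mem (v : Fin m → L) (f : (Fin m → L) →ₗ[L] (Fin m → L)) (l : ℕ) :
    ∀ ω ∈ ⋀[L]^l (Fin m → L),
      (LinearMap.mulLeft L (ι L v) ∘ₗ (ExteriorAlgebra.map f).toLinearMap) ω ∈
        ⋀[L]^(l + 1) (Fin m → L) := by
  intro ω hω
  rw [← ιMulti_span_fixedDegree] at hω
  induction hω using Submodule.span_induction with
  | mem x hx =>
    obtain ⟨w, rfl⟩ := hx
    refine ιMulti_range L (l + 1) ⟨Fin.cons v (f ∘ w), ?_⟩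
    rw [ιMulti_succ_apply]
    simp [Matrix.vecTail, Function.comp_def]
  | zero => rw [map_zero]; exact zero_mem _
  | add a b _ _ ha hb => rw [map_add]; exact add_mem ha hb
  | smul c a _ ha => rw [map_smul]; exact Submodule.smul_mem _ _ ha

lemma X_mul_mem (j : Fin m) (s : ℕ) : ∀ F ∈ homogeneousSubmodule (Fin m) L s,
    LinearMap.mulLeft L (X j) F ∈ homogeneousSubmodule (Fin m) L (s + 1) := by
  intro F hF
  rw [LinearMap.mulLeft_apply, add_comm]
  exact (isHomogeneous_X L j).mul hF

variable {G : ℕ → Type*} [∀ s, AddCommGroup (G s)] [∀ s, Module L (G s)]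
  (e : ∀ s, homogeneousSubmodule (Fin m) L s ≃ₗ[L] G s)

/-- The degree `s` part of the polynomial ring, as an isomorphic module embedded in it. -/
noncomputable def polyEmb (s : ℕ) : G s →ₗ[L] MvPolynomial (Fin m) L :=
  (homogeneousSubmodule (Fin m) L s).subtype ∘ₗ (e s).symm.toLinearMap

/-- Multiplication by a variable `X j`. -/
noncomputable def mulVar (j : Fin m) (s : ℕ) : G s →ₗ[L] G (s + 1) :=
  (e (s + 1)).toLinearMap ∘ₗ (LinearMap.mulLeft L (X j)).restrict (X_mul_mem j s) ∘ₗ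
    (e s).symm.toLinearMap

lemma mulVar_apply_equiv (j : Fin m) (s : ℕ) (F : homogeneousSubmodule (Fin m) L s)
    (h : X j * (F : MvPolynomial (Fin m) L) ∈ homogeneousSubmodule (Fin m) L (s + 1)) :
    mulVar e j s (e s F) = e (s + 1) ⟨X j * (F : MvPolynomial (Fin m) L), h⟩ := by
  simp only [mulVar, LinearMap.comp_apply, LinearEquiv.coe_coe, LinearEquiv.symm_apply_apply]
  refine congrArg (e (s + 1)) (Subtype.ext ?_)
  rw [LinearMap.coe_restrict_apply, LinearMap.mulLeft_apply]

/-- The Koszul differential on the strands `Λ^l(L^m) ⊗ G s`. -/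
noncomputable def strandDifferential (l s : ℕ) :
    ⋀[L]^(l + 1) (Fin m → L) ⊗[L] G s →ₗ[L] ⋀[L]^l (Fin m → L) ⊗[L] G (s + 1) :=
  ∑ j, TensorProduct.map ((contract (LinearMap.proj j)).restrict (contract_mem _ l))
    (mulVar e j s)

/-- The contracting homotopy on the strands `Λ^l(L^m) ⊗ G s`. -/
noncomputable def strandHomotopy (l s : ℕ) :
    ⋀[L]^l (Fin m → L) ⊗[L] G (s + 1) →ₗ[L] ⋀[L]^(l + 1) (Fin m → L) ⊗[L] G s :=
  ∑ i : Fin m, TensorProduct.map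
    (LinearMap.restrict _ (ι_mul_map_mem (Pi.single i 1) (tailProj L m i) l))
    ((e s).toLinearMap ∘ₗ (divFirst L i).restrict (fun _ h => divFirst_mem i h) ∘ₗ
      (e (s + 1)).symm.toLinearMap)

/-- The embedding of the strands in the full Koszul complex. -/
noncomputable def strandEmb (l s : ℕ) : ⋀[L]^l (Fin m → L) ⊗[L] G s →ₗ[L]
    ExteriorAlgebra L (Fin m → L) ⊗[L] MvPolynomial (Fin m) L :=
  TensorProduct.map (⋀[L]^l (Fin m → L)).subtype (polyEmb e s)

lemma strandEmb_injective (l s : ℕ) : Function.Injective (strandEmb e l s) := by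
  have h : strandEmb e l s =
      LinearMap.rTensor _ (⋀[L]^l (Fin m → L)).subtype ∘ₗ LinearMap.lTensor _ (polyEmb e s) := by
    rw [LinearMap.rTensor_comp_lTensor]; rfl
  rw [h, LinearMap.coe_comp]
  refine (Module.Flat.rTensor_preserves_injective_linearMap _ (Submodule.subtype_injective _)).comp
    (Module.Flat.lTensor_preserves_injective_linearMap _ ?_)
  exact (Submodule.subtype_injective _).comp (e s).symm.injective

lemma strandEmb_strandDifferential (l s : ℕ) (z : ⋀[L]^(l + 1) (Fin m → L) ⊗[L] G s) :
    strandEmb e l (s + 1) (strandDifferential e l s z) =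
      differential L m (strandEmb e (l + 1) s z) := by
  refine LinearMap.congr_fun (f := strandEmb e l (s + 1) ∘ₗ strandDifferential e l s)
    (g := differential L m ∘ₗ strandEmb e (l + 1) s) (TensorProduct.ext' fun ω g => ?_) z
  simp [strandEmb, strandDifferential, differential, polyEmb, mulVar]

lemma strandEmb_strandHomotopy (l s : ℕ) (z : ⋀[L]^l (Fin m → L) ⊗[L] G (s + 1)) :
    strandEmb e (l + 1) s (strandHomotopy e l s z) =
      homotopy L m (strandEmb e l (s + 1) z) := by
  refine LinearMap.congr_fun (f := strandEmb e (l + 1) s ∘ₗ strandHomotopy e l s)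
    (g := homotopy L m ∘ₗ strandEmb e l (s + 1)) (TensorProduct.ext' fun ω g => ?_) z
  simp [strandEmb, strandHomotopy, homotopy, polyEmb]

lemma homotopy_differential_add_strandEmb (l s : ℕ) (z : ⋀[L]^l (Fin m → L) ⊗[L] G (s + 1)) :
    homotopy L m (differential L m (strandEmb e l (s + 1) z)) +
      differential L m (homotopy L m (strandEmb e l (s + 1) z)) = strandEmb e l (s + 1) z := by
  induction z with
  | zero => simp
  | add a b ha hb =>
    simp only [map_add]
    rw [add_add_add_comm, ha, hb]
  | tmul ω g => exact homotopy_differential_add _ ((e (s + 1)).symm g).2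

lemma strandDifferential_strandHomotopy {l s : ℕ} {z : ⋀[L]^l (Fin m → L) ⊗[L] G (s + 1)}
    (hz : differential L m (strandEmb e l (s + 1) z) = 0) :
    strandDifferential e l s (strandHomotopy e l s z) = z := by
  apply strandEmb_injective e
  rw [strandEmb_strandDifferential, strandEmb_strandHomotopy]
  simpa [hz] using homotopy_differential_add_strandEmb e l s z

theorem strandDifferential_comp (l s : ℕ) :
    strandDifferential e l (s + 1) ∘ₗ strandDifferential e (l + 1) s = 0 := by
  refine LinearMap.ext fun z => strandEmb_injective e _ _ ?_
  simp [strandEmb_strandDifferential, differential_differential]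

theorem strandDifferential_exact (l s : ℕ) :
    Function.Exact (strandDifferential e (l + 1) s) (strandDifferential e l (s + 1)) := by
  intro z
  refine ⟨fun hz => ⟨strandHomotopy e (l + 1) s z, strandDifferential_strandHomotopy e ?_⟩, ?_⟩
  · rw [← strandEmb_strandDifferential, hz, map_zero]
  · rintro ⟨z, rfl⟩
    exact LinearMap.congr_fun (strandDifferential_comp e l s) z

theorem strandDifferential_surjective (s : ℕ) : Function.Surjective (strandDifferential e 0 s) := by
  refine fun z => ⟨strandHomotopy e 0 s z, strandDifferential_strandHomotopy e ?_⟩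
  induction z with
  | zero => simp
  | add a b ha hb => rw [map_add, map_add, ha, hb, add_zero]
  | tmul ω g => simp [strandEmb, differential_tmul, contract_eq_zero _ ω.2]

theorem strandDifferential_injective (l : ℕ) : Function.Injective (strandDifferential e l 0) := by
  have key : ∀ z, homotopy L m (differential L m (strandEmb e (l + 1) 0 z)) =
      strandEmb e (l + 1) 0 z := by
    intro z
    induction z with
    | zero => simp
    | add a b ha hb => simp only [map_add, ha, hb]
    | tmul ω g =>
      obtain ⟨c, hc⟩ : ∃ c : L, polyEmb e 0 g = c • 1 := by
        refine ⟨coeff 0 (polyEmb e 0 g), ?_⟩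
        rw [smul_eq_C_mul, mul_one]
        exact totalDegree_eq_zero_iff_eq_C.1
          ((totalDegree_zero_iff_isHomogeneous _).2 ((e 0).symm g).2)
      rw [strandEmb, map_tmul, hc, tmul_smul, map_smul, map_smul]
      simp [homotopy_differential_one, map_tailProj_self l ω.2]
  rw [injective_iff_map_eq_zero]
  intro z hz
  apply strandEmb_injective e
  rw [← key, ← strandEmb_strandDifferential, hz, map_zero, map_zero, map_zero]

end Strand

end Koszul

namespace IadicGr

open MvPolynomial

variable {R : Type} [CommRing R] {m : ℕ} (x : Fin m → R)

lemma mk_smul {J : Ideal R} {s : ℕ} (r : R) (z : IadicGr J s) :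
    (Ideal.Quotient.mk J r : R ⧸ J) • z = r • z := rfl

/-- Evaluation at `x` of the degree `s` part of a polynomial, modulo `J^(s+1)`. -/
def evalHom (s : ℕ) : MvPolynomial (Fin m) R →ₗ[R] IadicGr (Ideal.span (Set.range x)) s :=
  Submodule.mkQ _ ∘ₗ ((aeval x).toLinearMap ∘ₗ homogeneousComponent s).codRestrict
    (Ideal.span (Set.range x) ^ s) fun F => (Ideal.mem_span_pow_iff_exists_isHomogeneous x _).2
      ⟨_, homogeneousComponent_isHomogeneous s F, by simp⟩

lemma evalHom_apply (s : ℕ) {F : MvPolynomial (Fin m) R} (hF : F.IsHomogeneous s) :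
    evalHom x s F = Submodule.Quotient.mk ⟨eval x F,
      (Ideal.mem_span_pow_iff_exists_isHomogeneous x _).2 ⟨F, hF, rfl⟩⟩ := by
  refine congrArg Submodule.Quotient.mk (Subtype.ext ?_)
  simp [homogeneousComponent_eq_self hF, ← aeval_eq_eval]

/-- The `L`-linear map `L[X₁, …, X_m] → J^s/J^(s+1)` sending a monomial of degree `s` to its value
at `x`, and the other monomials to `0`. -/
def ofPoly (s : ℕ) : MvPolynomial (Fin m) (R ⧸ Ideal.span (Set.range x))
    →ₗ[R ⧸ Ideal.span (Set.range x)] IadicGr (Ideal.span (Set.range x)) s :=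
  (basisMonomials (Fin m) (R ⧸ Ideal.span (Set.range x))).constr
    (R ⧸ Ideal.span (Set.range x)) fun a => evalHom x s (monomial a 1)

lemma ofPoly_map (s : ℕ) (F : MvPolynomial (Fin m) R) :
    ofPoly x s (map (Ideal.Quotient.mk _) F) = evalHom x s F := by
  induction F using MvPolynomial.induction_on' with
  | monomial a r =>
    have h := (basisMonomials (Fin m) (R ⧸ Ideal.span (Set.range x))).constr_basis
      (R ⧸ Ideal.span (Set.range x)) (fun a => evalHom x s (monomial a 1)) a
    rw [coe_basisMonomials] at h
    rw [map_monomial, ← mul_one (Ideal.Quotient.mk _ r), ← smul_eq_mul, ← smul_monomial, map_smul,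
      ofPoly, h, mk_smul, ← map_smul, smul_monomial, smul_eq_mul, mul_one]
  | add p q hp hq => rw [map_add, map_add, map_add, hp, hq]

lemma exists_isHomogeneous_map_eq {S : Type*} [CommRing S] {f : R →+* S}
    (hf : Function.Surjective f) {s : ℕ} {F : MvPolynomial (Fin m) S} (hF : F.IsHomogeneous s) :
    ∃ F' : MvPolynomial (Fin m) R, F'.IsHomogeneous s ∧ map f F' = F := by
  obtain ⟨F', rfl⟩ := map_surjective f hf F
  refine ⟨homogeneousComponent s F', homogeneousComponent_isHomogeneous s F', ?_⟩
  ext d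
  rw [coeff_map, coeff_homogeneousComponent]
  split_ifs with h
  · rw [coeff_map]
  · rw [map_zero]
    by_contra hd
    exact h (by rw [Finsupp.degree_eq_weight_one]; exact hF (Ne.symm hd))

variable {x}

lemma ofPoly_bijective (hx : IsRegularSeq x) (s : ℕ) :
    Function.Bijective ((ofPoly x s).domRestrict (homogeneousSubmodule (Fin m) _ s)) := by
  constructor
  · rw [injective_iff_map_eq_zero]
    rintro ⟨F, hF⟩ h
    obtain ⟨F', hF', rfl⟩ := exists_isHomogeneous_map_eq Ideal.Quotient.mk_surjective hF
    rw [LinearMap.domRestrict_apply, ofPoly_map, evalHom_apply x s hF',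
      Submodule.Quotient.mk_eq_zero] at h
    have h' := hx.mem_map_C_of_eval_mem hF' h
    rw [mem_map_C_iff] at h'
    ext d
    change coeff d (map (Ideal.Quotient.mk (Ideal.span (Set.range x))) F') = 0
    rw [coeff_map]
    exact Ideal.Quotient.eq_zero_iff_mem.2 (h' d)
  · intro z
    obtain ⟨⟨f, hf⟩, rfl⟩ := Submodule.Quotient.mk_surjective _ z
    obtain ⟨F, hF, rfl⟩ := (Ideal.mem_span_pow_iff_exists_isHomogeneous x f).1 hf
    refine ⟨⟨map (Ideal.Quotient.mk _) F, hF.map _⟩, ?_⟩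
    rw [LinearMap.domRestrict_apply, ofPoly_map, evalHom_apply x s hF]

/-- The degree `s` part of `L[X₁, …, X_m]` is isomorphic to `J^s/J^(s+1)`. -/
def polyEquiv (hx : IsRegularSeq x) (s : ℕ) :
    homogeneousSubmodule (Fin m) (R ⧸ Ideal.span (Set.range x)) s
      ≃ₗ[R ⧸ Ideal.span (Set.range x)] IadicGr (Ideal.span (Set.range x)) s :=
  LinearEquiv.ofBijective _ (ofPoly_bijective hx s)

lemma polyEquiv_apply_map (hx : IsRegularSeq x) {s : ℕ} {F : MvPolynomial (Fin m) R}
    (hF : F.IsHomogeneous s)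
    (h : map (Ideal.Quotient.mk (Ideal.span (Set.range x))) F ∈
      homogeneousSubmodule (Fin m) (R ⧸ Ideal.span (Set.range x)) s) :
    polyEquiv hx s ⟨map (Ideal.Quotient.mk (Ideal.span (Set.range x))) F, h⟩ =
      Submodule.Quotient.mk ⟨eval x F,
        (Ideal.mem_span_pow_iff_exists_isHomogeneous x _).2 ⟨F, hF, rfl⟩⟩ := by
  rw [← evalHom_apply x s hF, ← ofPoly_map]
  rfl

lemma mulVar_polyEquiv_mk (hx : IsRegularSeq x) (j : Fin m) (s : ℕ)
    (f : ↥(Ideal.span (Set.range x) ^ s)) :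
    Koszul.mulVar (polyEquiv hx) j s (Submodule.Quotient.mk f) =
      (Submodule.Quotient.mk
        ⟨x j * (f : R), mul_mem_pow_succ _ (Ideal.subset_span (Set.mem_range_self j)) f⟩ :
          IadicGr (Ideal.span (Set.range x)) (s + 1)) := by
  obtain ⟨f, hf⟩ := f
  obtain ⟨F, hF, rfl⟩ := (Ideal.mem_span_pow_iff_exists_isHomogeneous x f).1 hf
  have hXF : (X j * F).IsHomogeneous (s + 1) := by
    rw [add_comm]
    exact (isHomogeneous_X R j).mul hF
  have hmap : (X j * MvPolynomial.map (Ideal.Quotient.mk (Ideal.span (Set.range x))) F :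
      MvPolynomial (Fin m) (R ⧸ Ideal.span (Set.range x))) =
      map (Ideal.Quotient.mk (Ideal.span (Set.range x))) (X j * F) := by
    rw [map_mul, map_X]
  rw [← polyEquiv_apply_map hx hF (hF.map _), Koszul.mulVar_apply_equiv (polyEquiv hx) j s _
    (by rw [hmap]; exact hXF.map _)]
  simp only [hmap]
  rw [polyEquiv_apply_map hx hXF]
  refine congrArg Submodule.Quotient.mk (Subtype.ext ?_)
  simp

end IadicGr

lemma Koszul.strandDifferential_wedge_single {L : Type} [CommRing L] {m : ℕ} {G : ℕ → Type*}
    [∀ s, AddCommGroup (G s)] [∀ s, Module L (G s)]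
    (e : ∀ s, MvPolynomial.homogeneousSubmodule (Fin m) L s ≃ₗ[L] G s) (l s : ℕ)
    (i : Fin (l + 1) → Fin m) (g : G s) :
    Koszul.strandDifferential e l s
        ((wedge (l + 1) fun k => Pi.single (i k) (1 : L)) ⊗ₜ[L] g) =
      ∑ k : Fin (l + 1), ((-1 : ℤ) ^ (k : ℕ)) •
        ((wedge l fun t => Pi.single (i (k.succAbove t)) (1 : L)) ⊗ₜ[L]
          Koszul.mulVar e (i k) s g) := by
  have h : ∀ j : Fin m,
      (ExteriorAlgebra.contract (LinearMap.proj j)).restrict (Koszul.contract_mem _ l)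
        (wedge (l + 1) fun k => Pi.single (i k) (1 : L)) =
      ∑ k : Fin (l + 1), (-1 : ℤ) ^ (k : ℕ) • (if i k = j then (1 : L) else 0) •
        wedge l fun t => Pi.single (i (k.succAbove t)) (1 : L) := by
    intro j
    apply Subtype.ext
    rw [LinearMap.coe_restrict_apply]
    simp only [wedge, ExteriorAlgebra.contract_ιMulti, AddSubmonoidClass.coe_finsetSum]
    refine Finset.sum_congr rfl fun k _ => ?_
    by_cases hk : i k = j
    · subst hk
      simp
    · simp [hk, Ne.symm hk]
  rw [Koszul.strandDifferential, LinearMap.sum_apply]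
  simp only [TensorProduct.map_tmul, h, sum_tmul]
  rw [Finset.sum_comm]
  refine Finset.sum_congr rfl fun k _ => ?_
  rw [Finset.sum_eq_single (i k)]
  · rw [if_pos rfl, one_smul, smul_tmul']
  · intro j _ hj
    rw [if_neg hj.symm, zero_smul, smul_zero, zero_tmul]
  · simp

theorem statement_13 {R : Type} [CommRing R] {m : ℕ} (hm : 1 ≤ m) (x : Fin m → R)
    (hreg : RingTheory.Sequence.IsRegular R (List.ofFn x))
    (J : Ideal R) (hJ : J = Ideal.span (Set.range x)) :
    ∃ δ : ∀ l s : ℕ,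
        ((↥(⋀[R ⧸ J]^(l + 1) (Fin m → R ⧸ J))) ⊗[R ⧸ J] IadicGr J s) →ₗ[R ⧸ J]
        ((↥(⋀[R ⧸ J]^l (Fin m → R ⧸ J))) ⊗[R ⧸ J] IadicGr J (s + 1)),
      -- the defining formula for δ on elementary wedges tensor residue classes
      (∀ (l s : ℕ) (i : Fin (l + 1) → Fin m) (f : ↥(J ^ s)),
        δ l s ((wedge (l + 1) fun k => Pi.single (i k) (1 : R ⧸ J)) ⊗ₜ[R ⧸ J]
            (Submodule.Quotient.mk f : IadicGr J s)) =
          ∑ j : Fin (l + 1), ((-1 : ℤ) ^ (j : ℕ)) •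
            ((wedge l fun k => Pi.single (i (j.succAbove k)) (1 : R ⧸ J)) ⊗ₜ[R ⧸ J]
              (Submodule.Quotient.mk
                ⟨x (i j) * (f : R),
                  mul_mem_pow_succ J
                    (by rw [hJ]; exact Ideal.subset_span ⟨i j, rfl⟩) f⟩ :
                IadicGr J (s + 1)))) ∧
      -- δ ∘ δ = 0
      (∀ l s : ℕ, (δ l (s + 1)).comp (δ (l + 1) s) = 0) ∧
      -- exactness of the finite complexes, for every N ≥ 1
      (∀ N : ℕ, 1 ≤ N →
        (∀ l : ℕ, N = l + 1 → Function.Injective (δ l 0)) ∧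
        (∀ s : ℕ, N = s + 1 → Function.Surjective (δ 0 s)) ∧
        (∀ l s : ℕ, N = l + s + 2 → Function.Exact (δ (l + 1) s) (δ l (s + 1)))) := by
  subst hJ
  have hx := isRegularSeq_of_isWeaklyRegular hreg.toIsWeaklyRegular
  refine ⟨Koszul.strandDifferential (IadicGr.polyEquiv hx), fun l s i f => ?_,
    Koszul.strandDifferential_comp _, fun N _ => ⟨fun l _ => ?_, fun s _ => ?_, fun l s _ => ?_⟩⟩
  · rw [Koszul.strandDifferential_wedge_single]
    simp only [IadicGr.mulVar_polyEquiv_mk]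
  · exact Koszul.strandDifferential_injective _ l
  · exact Koszul.strandDifferential_surjective _ s
  · exact Koszul.strandDifferential_exact _ l s

end
end
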